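/- arXiv:1906.10360 — 5 statements merged into one kernel-verified Lean document; each statement's English description precedes it below -/
import Mathlib

section
/- Let n ∈ ℕ, R₀ > 0, a₁,…,aₙ ∈ B_{R₀}(0) ⊂ ℝ² and v₁,…,vₙ > 0. Let λ > 1 be defined by Σᵢ vᵢ = (λ² − 1)πR₀². Define σ = min{ minᵢ (1 − |aᵢ|/R₀)² / (vᵢ/Σₖvₖ), min_{i≠j} |aᵢ − aⱼ|² / (R₀² (√(vᵢ/Σₖvₖ) + √(vⱼ/Σₖvₖ))²) }. If either σ ≥ 1, or σ < 1 and λ² < 1/(1 − σ), then the cavitation configuration ((aᵢ)ᵢ₌₁ⁿ, (vᵢ)ᵢ₌₁ⁿ) is attainable through an evolution of circular cavities. -/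
open scoped BigOperators

/-- A cavitation configuration `(a, v)` attainable through an evolution of circular
cavities: the data of the evolutions `z` (centers) and `L` (radii) with all the
required properties, for the stretch factor `lam`. -/
def IsCircEvolution (n : ℕ) (R₀ lam : ℝ) (a : Fin n → ℂ) (v : Fin n → ℝ)
    (z : Fin n → ℝ → ℂ) (L : Fin n → ℝ → ℝ) : Prop :=
  (∀ i, ContDiffOn ℝ 1 (z i) (Set.Icc 1 lam)) ∧
  (∀ i, ∀ t ∈ Set.Icc (1:ℝ) lam, 0 ≤ L i t) ∧
  (∀ t ∈ Set.Icc (1:ℝ) lam, ∑ i, Real.pi * L i t ^ 2 = (t ^ 2 - 1) * Real.pi * R₀ ^ 2) ∧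
  (∀ i, ContDiffOn ℝ 1 (fun t => L i t ^ 2) (Set.Icc 1 lam)) ∧
  (∀ i, z i 1 = a i) ∧
  (∀ i, L i 1 = 0) ∧
  (∀ i, Real.pi * L i lam ^ 2 = v i) ∧
  (∀ t ∈ Set.Icc (1:ℝ) lam, Pairwise (fun i j =>
    Disjoint (Metric.closedBall (z i t) (L i t)) (Metric.closedBall (z j t) (L j t)))) ∧
  (∀ t ∈ Set.Icc (1:ℝ) lam, ∀ i, Metric.closedBall (z i t) (L i t) ⊆ Metric.ball (0:ℂ) (t * R₀))

theorem stmt_0 (n : ℕ) (R₀ : ℝ) (hR₀ : 0 < R₀) (a : Fin n → ℂ) (v : Fin n → ℝ)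
    (ha : ∀ i, a i ∈ Metric.ball (0:ℂ) R₀) (hv : ∀ i, 0 < v i)
    (lam : ℝ) (hlam : 1 < lam)
    (hsum : ∑ i, v i = (lam ^ 2 - 1) * Real.pi * R₀ ^ 2)
    (σ : ℝ)
    (hσ : σ = sInf ((Set.range fun i => (1 - ‖a i‖ / R₀) ^ 2 / (v i / (∑ k, v k))) ∪
      {x : ℝ | ∃ i j, i ≠ j ∧ x = ‖a i - a j‖ ^ 2 /
        (R₀ ^ 2 * (Real.sqrt (v i / (∑ k, v k)) + Real.sqrt (v j / (∑ k, v k))) ^ 2)}))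
    (hcase : 1 ≤ σ ∨ (σ < 1 ∧ lam ^ 2 < 1 / (1 - σ))) :
    ∃ z L, IsCircEvolution n R₀ lam a v z L := by
  set V := ∑ k, v k with hV
  have hVpos : 0 < V := by
    rw [hsum]
    have : 0 < lam ^ 2 - 1 := by nlinarith
    positivity
  have hw : ∀ i, 0 < v i / V := fun i => div_pos (hv i) hVpos
  have hwsum : ∑ i, v i / V = 1 := by
    rw [← Finset.sum_div, ← hV, div_self hVpos.ne']
  have hbdd : BddBelow ((Set.range fun i => (1 - ‖a i‖ / R₀) ^ 2 / (v i / V)) ∪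
      {x : ℝ | ∃ i j, i ≠ j ∧ x = ‖a i - a j‖ ^ 2 /
        (R₀ ^ 2 * (Real.sqrt (v i / V) + Real.sqrt (v j / V)) ^ 2)}) := by
    refine ⟨0, ?_⟩
    rintro x (⟨i, rfl⟩ | ⟨i, j, -, rfl⟩)
    · exact div_nonneg (sq_nonneg _) (hw i).le
    · positivity
  have hσ₁ : ∀ i, σ * (v i / V) ≤ (1 - ‖a i‖ / R₀) ^ 2 := fun i => by
    rw [← le_div_iff₀ (hw i), hσ]
    exact csInf_le hbdd (Or.inl ⟨i, rfl⟩)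
  have hσ₂ : ∀ i j, i ≠ j →
      σ * (R₀ ^ 2 * (Real.sqrt (v i / V) + Real.sqrt (v j / V)) ^ 2) ≤ ‖a i - a j‖ ^ 2 :=
    fun i j hij => by
      have hi := Real.sqrt_pos.2 (hw i)
      have hj := Real.sqrt_pos.2 (hw j)
      rw [← le_div_iff₀ (by positivity), hσ]
      exact csInf_le hbdd (Or.inr ⟨i, j, hij, rfl⟩)
  have ht : ∀ t ∈ Set.Icc (1 : ℝ) lam, t ^ 2 - 1 < t ^ 2 * σ := by
    rintro t ⟨h1, h2⟩
    rcases hcase with h | ⟨h, h'⟩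
    · nlinarith [mul_nonneg (sq_nonneg t) (sub_nonneg.2 h)]
    · rw [lt_div_iff₀ (by linarith)] at h'
      have : t ^ 2 ≤ lam ^ 2 := by gcongr
      nlinarith [mul_le_mul_of_nonneg_right this (sub_pos.2 h).le]
  have hsq : ∀ t ∈ Set.Icc (1 : ℝ) lam, Real.sqrt (t ^ 2 - 1) ^ 2 = t ^ 2 - 1 :=
    fun t h => Real.sq_sqrt (by nlinarith [h.1])
  have hL : ∀ i, ∀ t ∈ Set.Icc (1 : ℝ) lam,
      (Real.sqrt (t ^ 2 - 1) * R₀ * Real.sqrt (v i / V)) ^ 2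
        = (t ^ 2 - 1) * R₀ ^ 2 * (v i / V) := fun i t h => by
    rw [mul_pow, mul_pow, hsq t h, Real.sq_sqrt (hw i).le]
  refine ⟨fun i t => (t : ℂ) * a i, fun i t => Real.sqrt (t ^ 2 - 1) * R₀ * Real.sqrt (v i / V),
    ?_, ?_, ?_, ?_, ?_, ?_, ?_, ?_, ?_⟩
  · exact fun i => (Complex.ofRealCLM.contDiff.mul contDiff_const).contDiffOn
  · intro i t _
    positivity
  · intro t h
    rw [Finset.sum_congr rfl fun i _ => by rw [hL i t h], ← Finset.mul_sum, ← Finset.mul_sum,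
      hwsum]
    ring
  · intro i
    have : ContDiff ℝ 1 fun t : ℝ => (t ^ 2 - 1) * R₀ ^ 2 * (v i / V) := by fun_prop
    exact this.contDiffOn.congr (hL i)
  · simp
  · simp
  · intro i
    rw [hL i lam ⟨hlam.le, le_rfl⟩]
    calc Real.pi * ((lam ^ 2 - 1) * R₀ ^ 2 * (v i / V))
        = (lam ^ 2 - 1) * Real.pi * R₀ ^ 2 * (v i / V) := by ring
      _ = v i := by rw [← hsum, mul_div_cancel₀ _ hVpos.ne']
  · intro t h i j hij
    apply Metric.closedBall_disjoint_closedBall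
    have h0 : 0 < t := by linarith [h.1]
    have hi := Real.sqrt_pos.2 (hw i)
    have hj := Real.sqrt_pos.2 (hw j)
    rw [dist_eq_norm, ← mul_sub, norm_mul, Complex.norm_of_nonneg h0.le, ← mul_add]
    refine lt_of_pow_lt_pow_left₀ 2 (by positivity) ?_
    rw [mul_pow, mul_pow, mul_pow, hsq t h, mul_assoc]
    calc (t ^ 2 - 1) * (R₀ ^ 2 * (Real.sqrt (v i / V) + Real.sqrt (v j / V)) ^ 2)
        < t ^ 2 * σ * (R₀ ^ 2 * (Real.sqrt (v i / V) + Real.sqrt (v j / V)) ^ 2) :=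
          mul_lt_mul_of_pos_right (ht t h) (by positivity)
      _ ≤ t ^ 2 * ‖a i - a j‖ ^ 2 := by
          rw [mul_assoc]
          exact mul_le_mul_of_nonneg_left (hσ₂ i j hij) (sq_nonneg t)
  · intro t h i
    apply Metric.closedBall_subset_ball'
    have h0 : 0 < t := by linarith [h.1]
    have hai : ‖a i‖ / R₀ < 1 := by
      rw [div_lt_one hR₀]
      simpa using ha i
    have key : Real.sqrt (t ^ 2 - 1) * Real.sqrt (v i / V) < t * (1 - ‖a i‖ / R₀) := by
      refine lt_of_pow_lt_pow_left₀ 2 (mul_nonneg h0.le (sub_pos.2 hai).le) ?_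
      rw [mul_pow, mul_pow, hsq t h, Real.sq_sqrt (hw i).le]
      calc (t ^ 2 - 1) * (v i / V) < t ^ 2 * σ * (v i / V) :=
            mul_lt_mul_of_pos_right (ht t h) (hw i)
        _ ≤ t ^ 2 * (1 - ‖a i‖ / R₀) ^ 2 := by
            rw [mul_assoc]
            exact mul_le_mul_of_nonneg_left (hσ₁ i) (sq_nonneg t)
    rw [dist_zero_right, norm_mul, Complex.norm_of_nonneg h0.le]
    have hmul := mul_lt_mul_of_pos_right key hR₀
    have hcancel : ‖a i‖ / R₀ * R₀ = ‖a i‖ := div_mul_cancel₀ _ hR₀.ne'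
    have : t * (1 - ‖a i‖ / R₀) * R₀ = t * R₀ - t * ‖a i‖ := by
      rw [mul_assoc, sub_mul, hcancel]
      ring
    linarith
end

section
/- Let n ∈ ℕ, R₀ > 0, and a₁,…,aₙ ∈ B_{R₀}(0) ⊂ ℝ². Suppose d₁,…,dₙ > 0 are such that the closed disks B̄_{dᵢ}(aᵢ), i = 1,…,n, are pairwise disjoint and contained in B_{R₀}(0). Then the cavitation configuration ((aᵢ)ᵢ₌₁ⁿ, (vᵢ)ᵢ₌₁ⁿ) with vᵢ = πdᵢ² · (1 − (Σₖ πdₖ²)/(πR₀²))⁻¹ for each i ∈ {1,…,n} is attainable through an evolution of circular cavities. -/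
open scoped BigOperators

/-- Pairwise disjoint closed disks contained in an open disk have total area strictly less than
the area of that disk. -/
theorem sum_sq_radius_lt_of_disjoint_closedBall {ι : Type*} [Fintype ι] {R : ℝ} (hR : 0 < R)
    (a : ι → ℂ) (d : ι → ℝ) (hd : ∀ i, 0 ≤ d i)
    (hdisj : Pairwise (fun i j =>
      Disjoint (Metric.closedBall (a i) (d i)) (Metric.closedBall (a j) (d j))))
    (hsub : ∀ i, Metric.closedBall (a i) (d i) ⊆ Metric.ball (0 : ℂ) R) :
    ∑ i, d i ^ 2 < R ^ 2 := by
  have hclosed : IsClosed (⋃ i, Metric.closedBall (a i) (d i)) :=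
    isClosed_iUnion_of_finite fun i => Metric.isClosed_closedBall
  obtain ⟨r, ⟨hr0, hrR⟩, hr⟩ :=
    exists_pos_lt_subset_ball hR hclosed (Set.iUnion_subset hsub)
  have hvol := MeasureTheory.measure_mono (μ := MeasureTheory.volume) hr
  rw [MeasureTheory.measure_iUnion hdisj fun i => Metric.isClosed_closedBall.measurableSet,
    tsum_fintype] at hvol
  simp_rw [Complex.volume_closedBall, Complex.volume_ball] at hvol
  rw [← Finset.sum_mul, ENNReal.mul_le_mul_iff_left (by simp [NNReal.pi_ne_zero]) (by simp)] at hvol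
  simp_rw [← ENNReal.ofReal_pow (hd _)] at hvol
  rw [← ENNReal.ofReal_pow hr0.le, ← ENNReal.ofReal_sum_of_nonneg fun i _ => sq_nonneg (d i),
    ENNReal.ofReal_le_ofReal_iff (sq_nonneg r)] at hvol
  exact hvol.trans_lt (pow_lt_pow_left₀ hrR hr0.le two_ne_zero)

/-- If `L ≤ t * d` with `t > 0`, then dividing by `t` maps the disk of center `t * a` and radius
`L` into the disk of center `a` and radius `d`. -/
theorem div_mem_closedBall_of_mem_closedBall_mul {t L d : ℝ} {a x : ℂ} (ht : 0 < t)
    (hL : L ≤ t * d) (hx : x ∈ Metric.closedBall ((t : ℂ) * a) L) :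
    x / t ∈ Metric.closedBall a d := by
  have ht' : (t : ℂ) ≠ 0 := by exact_mod_cast ht.ne'
  rw [mem_closedBall_iff_norm] at hx ⊢
  have h : x / t - a = (x - t * a) / t := by field_simp
  rw [h, norm_div, Complex.norm_real, Real.norm_of_nonneg ht.le, div_le_iff₀ ht]
  linarith

theorem stmt_2 (n : ℕ) (hn : 0 < n) (R₀ : ℝ) (hR₀ : 0 < R₀) (a : Fin n → ℂ)
    (ha : ∀ i, a i ∈ Metric.ball (0:ℂ) R₀) (d : Fin n → ℝ) (hd : ∀ i, 0 < d i)
    (hdisj : Pairwise (fun i j =>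
      Disjoint (Metric.closedBall (a i) (d i)) (Metric.closedBall (a j) (d j))))
    (hsub : ∀ i, Metric.closedBall (a i) (d i) ⊆ Metric.ball (0:ℂ) R₀) :
    ∃ lam : ℝ, 1 < lam ∧
      (∑ i, Real.pi * d i ^ 2 * (1 - (∑ k, Real.pi * d k ^ 2) / (Real.pi * R₀ ^ 2))⁻¹)
        = (lam ^ 2 - 1) * Real.pi * R₀ ^ 2 ∧
      ∃ z L, IsCircEvolution n R₀ lam a
        (fun i => Real.pi * d i ^ 2 * (1 - (∑ k, Real.pi * d k ^ 2) / (Real.pi * R₀ ^ 2))⁻¹)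
        z L := by
  have hlt : ∑ i, d i ^ 2 < R₀ ^ 2 :=
    sum_sq_radius_lt_of_disjoint_closedBall hR₀ a d (fun i => (hd i).le) hdisj hsub
  have hpos : 0 < ∑ i, d i ^ 2 :=
    Finset.sum_pos (fun i _ => pow_pos (hd i) 2) ⟨⟨0, hn⟩, Finset.mem_univ _⟩
  have hfrac : (∑ k, Real.pi * d k ^ 2) / (Real.pi * R₀ ^ 2) = (∑ i, d i ^ 2) / R₀ ^ 2 := by
    rw [← Finset.mul_sum, mul_div_mul_left _ _ Real.pi_ne_zero]
  rw [hfrac]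
  obtain ⟨s, hs⟩ : ∃ s, s = (∑ i, d i ^ 2) / R₀ ^ 2 := ⟨_, rfl⟩
  have hsum : ∑ i, d i ^ 2 = s * R₀ ^ 2 := by
    rw [hs, div_mul_cancel₀ _ (pow_pos hR₀ 2).ne']
  rw [← hs]
  have hs0 : 0 < s := hs ▸ div_pos hpos (pow_pos hR₀ 2)
  have hs1 : 0 < 1 - s := by
    rw [sub_pos, hs, div_lt_one (pow_pos hR₀ 2)]
    exact hlt
  have hlam2 : Real.sqrt (1 - s)⁻¹ ^ 2 = (1 - s)⁻¹ := Real.sq_sqrt (inv_pos.2 hs1).le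
  have hlam1 : 1 < Real.sqrt (1 - s)⁻¹ := by
    rw [Real.lt_sqrt zero_le_one, one_pow]
    exact (one_lt_inv₀ hs1).2 (by linarith)
  generalize Real.sqrt (1 - s)⁻¹ = lam at hlam2 hlam1
  have hLsq : ∀ i, ∀ t : ℝ, 1 ≤ t →
      (d i * Real.sqrt ((t ^ 2 - 1) / s)) ^ 2 = d i ^ 2 * ((t ^ 2 - 1) / s) := fun i t ht => by
    rw [mul_pow, Real.sq_sqrt (div_nonneg (by nlinarith) hs0.le)]
  have hLle : ∀ i, ∀ t ∈ Set.Icc (1 : ℝ) lam,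
      d i * Real.sqrt ((t ^ 2 - 1) / s) ≤ t * d i := fun i t ht => by
    rw [mul_comm t]
    refine mul_le_mul_of_nonneg_left ?_ (hd i).le
    rw [Real.sqrt_le_left (by linarith [ht.1]), div_le_iff₀ hs0]
    have h1 : t ^ 2 ≤ (1 - s)⁻¹ := by
      rw [← hlam2]
      exact pow_le_pow_left₀ (by linarith [ht.1]) ht.2 2
    have h2 := mul_le_mul_of_nonneg_right h1 hs1.le
    rw [inv_mul_cancel₀ hs1.ne'] at h2
    linarith
  have hlam_sub : lam ^ 2 - 1 = s * (1 - s)⁻¹ := by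
    rw [hlam2]
    field_simp
    ring
  refine ⟨lam, hlam1, ?_, fun i t => (t : ℂ) * a i,
    fun i t => d i * Real.sqrt ((t ^ 2 - 1) / s), ?_, ?_, ?_, ?_, ?_, ?_, ?_, ?_, ?_⟩
  · rw [← Finset.sum_mul, ← Finset.mul_sum, hsum, hlam_sub]
    ring
  · exact fun i => (Complex.ofRealCLM.contDiff.mul contDiff_const).contDiffOn
  · exact fun i t _ => mul_nonneg (hd i).le (Real.sqrt_nonneg _)
  · intro t ht
    simp_rw [hLsq _ t ht.1]
    rw [← Finset.mul_sum, ← Finset.sum_mul, hsum]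
    field_simp
  · intro i
    refine ContDiffOn.congr (f := fun t => d i ^ 2 * ((t ^ 2 - 1) / s)) ?_
      fun t ht => hLsq i t ht.1
    fun_prop
  · simp
  · simp
  · intro i
    beta_reduce
    rw [hLsq i lam hlam1.le, hlam_sub]
    field_simp
  · intro t ht i j hij
    have ht0 : 0 < t := by linarith [ht.1]
    refine Set.disjoint_left.2 fun x hxi hxj => ?_
    exact Set.disjoint_left.1 (hdisj hij)
      (div_mem_closedBall_of_mem_closedBall_mul ht0 (hLle i t ht) hxi)
      (div_mem_closedBall_of_mem_closedBall_mul ht0 (hLle j t ht) hxj)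
  · intro t ht i x hx
    have ht0 : 0 < t := by linarith [ht.1]
    have h := hsub i (div_mem_closedBall_of_mem_closedBall_mul ht0 (hLle i t ht) hx)
    rw [mem_ball_zero_iff, norm_div, Complex.norm_real, Real.norm_of_nonneg ht0.le,
      div_lt_iff₀ ht0] at h
    rw [mem_ball_zero_iff]
    linarith
end

section
/- For every δ ∈ (0,1) there exists a constant C(δ) > 0 with the following property. Let n ∈ ℕ, z₀,…,zₙ ∈ ℝ², d, r₀,…,rₙ > 0 with d/r₀ ≥ δ, suppose d ≤ rᵢ for all i ∈ {1,…,n}, and suppose the closed disks B̄_{rᵢ+d}(zᵢ), i = 1,…,n, are pairwise disjoint and contained in B_{r₀−d}(z₀). Set E = B_{r₀}(z₀) ∖ ⋃ᵢ₌₁ⁿ B̄_{rᵢ}(zᵢ). Then for every function φ : ℝ² → ℝ that is continuously differentiable on E, with φ and its gradient Dφ square-integrable on E, with ∫_E |Dφ|² dx = 1 and ∫_E φ dx = 0, one has ∫_E φ² dx ≤ C(δ)² r₀². -/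
open scoped BigOperators

open MeasureTheory Metric Set

theorem sq_lintegral_le_measure_univ_mul {α : Type*} [MeasurableSpace α] {μ : Measure α}
    {f : α → ENNReal} (hf : AEMeasurable f μ) :
    (∫⁻ x, f x ∂μ) ^ 2 ≤ μ univ * ∫⁻ x, f x ^ 2 ∂μ := by
  have h := ENNReal.lintegral_mul_le_Lp_mul_Lq μ Real.HolderConjugate.two_two
    (f := fun _ => 1) aemeasurable_const hf
  simp only [Pi.mul_apply, one_mul, ENNReal.one_rpow, lintegral_const] at h
  refine (pow_le_pow_left' h 2).trans_eq ?_
  rw [mul_pow, ← ENNReal.rpow_natCast, ← ENNReal.rpow_natCast, ← ENNReal.rpow_mul,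
    ← ENNReal.rpow_mul]
  norm_num

/-- The `L²` norm of the increment of `φ` along a fixed translation is controlled by the
Dirichlet energy. -/
theorem lintegral_translate_sub_sq_le {E A : Set ℂ} {φ : ℂ → ℝ} {v : ℂ} (hE : IsOpen E)
    (hφ : ContDiffOn ℝ 1 φ E)
    (hAE : ∀ x ∈ A, ∀ t ∈ Icc (0 : ℝ) 1, x + t • v ∈ E) (hA : MeasurableSet A) :
    ∫⁻ x in A, ‖φ (x + v) - φ x‖ₑ ^ 2 ≤
      ‖v‖ₑ ^ 2 * ∫⁻ x in E, ‖fderiv ℝ φ x‖ₑ ^ 2 := by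
  have hmeas : Measurable fun x => ‖fderiv ℝ φ x‖ₑ := (measurable_fderiv ℝ φ).enorm
  have hpt : ∀ x ∈ A, ‖φ (x + v) - φ x‖ₑ ^ 2 ≤
      ‖v‖ₑ ^ 2 * ∫⁻ t in Icc (0 : ℝ) 1, ‖fderiv ℝ φ (x + t • v)‖ₑ ^ 2 := by
    intro x hx
    have hγ : ContinuousOn (fun t : ℝ => x + t • v) (Icc 0 1) := by fun_prop
    have hderiv : ∀ t ∈ uIcc (0 : ℝ) 1,
        HasDerivAt (fun t : ℝ => φ (x + t • v)) (fderiv ℝ φ (x + t • v) v) t := by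
      intro t ht
      rw [uIcc_of_le zero_le_one] at ht
      have h1 : HasFDerivAt φ (fderiv ℝ φ (x + t • v)) (x + t • v) :=
        ((hφ.differentiableOn one_ne_zero).differentiableAt
          (hE.mem_nhds (hAE x hx t ht))).hasFDerivAt
      have h2 : HasDerivAt (fun t : ℝ => x + t • v) v t := by
        simpa using ((hasDerivAt_id t).smul_const v).const_add x
      exact h1.comp_hasDerivAt t h2
    have hcont : ContinuousOn (fun t : ℝ => fderiv ℝ φ (x + t • v) v) (uIcc 0 1) := by
      rw [uIcc_of_le zero_le_one]
      exact ((hφ.continuousOn_fderiv_of_isOpen hE le_rfl).comp hγ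
        (fun t ht => hAE x hx t ht)).clm_apply continuousOn_const
    have hftc := intervalIntegral.integral_eq_sub_of_hasDerivAt hderiv hcont.intervalIntegrable
    simp only [one_smul, zero_smul, add_zero] at hftc
    rw [← hftc, intervalIntegral.integral_of_le zero_le_one]
    have hm : Measurable fun t : ℝ => ‖fderiv ℝ φ (x + t • v)‖ₑ :=
      hmeas.comp (by fun_prop)
    calc ‖∫ t in Ioc (0 : ℝ) 1, fderiv ℝ φ (x + t • v) v‖ₑ ^ 2
        ≤ (∫⁻ t in Icc (0 : ℝ) 1, ‖fderiv ℝ φ (x + t • v)‖ₑ * ‖v‖ₑ) ^ 2 := by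
          refine pow_le_pow_left' ((enorm_integral_le_lintegral_enorm _).trans ?_) 2
          exact (lintegral_mono_set Ioc_subset_Icc_self).trans
            (lintegral_mono fun t => ContinuousLinearMap.le_opENorm _ _)
      _ ≤ _ := by
          rw [lintegral_mul_const _ hm, mul_pow, mul_comm]
          gcongr
          refine (sq_lintegral_le_measure_univ_mul hm.aemeasurable).trans_eq ?_
          simp
  calc ∫⁻ x in A, ‖φ (x + v) - φ x‖ₑ ^ 2
      ≤ ∫⁻ x in A, ‖v‖ₑ ^ 2 * ∫⁻ t in Icc (0 : ℝ) 1, ‖fderiv ℝ φ (x + t • v)‖ₑ ^ 2 :=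
        setLIntegral_mono' hA hpt
    _ = ‖v‖ₑ ^ 2 * ∫⁻ x in A, ∫⁻ t in Icc (0 : ℝ) 1, ‖fderiv ℝ φ (x + t • v)‖ₑ ^ 2 :=
        lintegral_const_mul' _ _ (by simp)
    _ = ‖v‖ₑ ^ 2 * ∫⁻ t in Icc (0 : ℝ) 1, ∫⁻ x in A, ‖fderiv ℝ φ (x + t • v)‖ₑ ^ 2 := by
        congr 1
        refine lintegral_lintegral_swap (Measurable.aemeasurable ?_)
        have hadd : Measurable fun p : ℂ × ℝ => p.1 + p.2 • v := by fun_prop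
        exact (hmeas.pow_const 2).comp hadd
    _ ≤ ‖v‖ₑ ^ 2 * ∫⁻ t in Icc (0 : ℝ) 1, ∫⁻ x in E, ‖fderiv ℝ φ x‖ₑ ^ 2 := by
        gcongr _ * ?_
        refine setLIntegral_mono' measurableSet_Icc fun t ht => ?_
        rw [← lintegral_indicator hA, ← lintegral_indicator hE.measurableSet,
          ← lintegral_add_right_eq_self (E.indicator _) (t • v)]
        refine lintegral_mono fun x => ?_
        by_cases hx : x ∈ A
        · rw [indicator_of_mem hx, indicator_of_mem (hAE x hx t ht)]
        · rw [indicator_of_notMem hx]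
          exact zero_le
    _ = _ := by simp

/-- The mean value of `φ` over the ball of radius `η` centred at `p`. -/
noncomputable def ballMean (φ : ℂ → ℝ) (η : ℝ) (p : ℂ) : ℝ :=
  (volume.real (ball (0 : ℂ) η))⁻¹ * ∫ u in ball (0 : ℂ) η, φ (p + u)

theorem integrableOn_ball_zero_comp_add {φ : ℂ → ℝ} {p : ℂ} {η : ℝ}
    (h : IntegrableOn φ (ball p η)) : IntegrableOn (fun u => φ (p + u)) (ball 0 η) := by
  have h1 : ((fun u => p + u) ⁻¹' ball p η) = ball (0 : ℂ) η := by
    ext u; simp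
  have := (measurePreserving_add_left volume p).integrableOn_comp_preimage
    (measurableEmbedding_addLeft p) (f := φ) (s := ball p η)
  rw [h1] at this
  exact this.2 h

theorem measureReal_ball_zero_pos {η : ℝ} (hη : 0 < η) : 0 < volume.real (ball (0 : ℂ) η) :=
  ENNReal.toReal_pos (measure_ball_pos _ _ hη).ne' measure_ball_lt_top.ne

theorem enorm_inv_measureReal_mul_integral_sq_le {f : ℂ → ℝ} {η : ℝ} (hη : 0 < η)
    (hf : AEStronglyMeasurable f (volume.restrict (ball 0 η))) :
    ‖(volume.real (ball (0 : ℂ) η))⁻¹ * ∫ u in ball (0 : ℂ) η, f u‖ₑ ^ 2 ≤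
      (volume (ball (0 : ℂ) η))⁻¹ * ∫⁻ u in ball (0 : ℂ) η, ‖f u‖ₑ ^ 2 := by
  have hV0 : volume (ball (0 : ℂ) η) ≠ 0 := (measure_ball_pos _ _ hη).ne'
  have hV1 : volume (ball (0 : ℂ) η) ≠ ⊤ := measure_ball_lt_top.ne
  have he : ‖(volume.real (ball (0 : ℂ) η))⁻¹‖ₑ = (volume (ball (0 : ℂ) η))⁻¹ := by
    rw [enorm_inv (measureReal_ball_zero_pos hη).ne', Real.enorm_of_nonneg measureReal_nonneg,
      Measure.real, ENNReal.ofReal_toReal hV1]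
  rw [enorm_mul, mul_pow, he]
  calc (volume (ball (0 : ℂ) η))⁻¹ ^ 2 * ‖∫ u in ball (0 : ℂ) η, f u‖ₑ ^ 2
      ≤ (volume (ball (0 : ℂ) η))⁻¹ ^ 2 *
          (volume (ball (0 : ℂ) η) * ∫⁻ u in ball (0 : ℂ) η, ‖f u‖ₑ ^ 2) := by
        gcongr
        refine (pow_le_pow_left' (enorm_integral_le_lintegral_enorm _) 2).trans ?_
        refine (sq_lintegral_le_measure_univ_mul hf.enorm).trans_eq ?_
        rw [Measure.restrict_apply_univ]
    _ = _ := by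
        rw [sq, mul_assoc, ← mul_assoc (volume (ball (0 : ℂ) η))⁻¹ (volume (ball (0 : ℂ) η)),
          ENNReal.inv_mul_cancel hV0 hV1, one_mul]

theorem enorm_ballMean_sub_ballMean_sq_le {E : Set ℂ} {φ : ℂ → ℝ} {p q : ℂ} {η : ℝ}
    (hη : 0 < η) (hE : IsOpen E) (hφ : ContDiffOn ℝ 1 φ E) (hint : IntegrableOn φ E)
    (hp : ball p (2 * η) ⊆ E) (hpq : dist p q ≤ η) :
    ‖ballMean φ η q - ballMean φ η p‖ₑ ^ 2 ≤
      (volume (ball (0 : ℂ) η))⁻¹ * (‖q - p‖ₑ ^ 2 * ∫⁻ x in E, ‖fderiv ℝ φ x‖ₑ ^ 2) := by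
  have hpE : ball p η ⊆ E := (ball_subset_ball (by linarith)).trans hp
  have hqE : ball q η ⊆ E :=
    (ball_subset_ball' (by rw [dist_comm]; linarith)).trans hp
  have ip := integrableOn_ball_zero_comp_add (hint.mono_set hpE)
  have iq := integrableOn_ball_zero_comp_add (hint.mono_set hqE)
  rw [ballMean, ballMean, ← mul_sub, ← integral_sub iq ip]
  refine (enorm_inv_measureReal_mul_integral_sq_le hη (iq.sub ip).1).trans ?_
  gcongr
  refine le_trans (le_of_eq ?_) (lintegral_translate_sub_sq_le (A := ball p η) hE hφ ?_
    measurableSet_ball)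
  · rw [← lintegral_indicator measurableSet_ball, ← lintegral_indicator measurableSet_ball,
      ← lintegral_add_left_eq_self ((ball p η).indicator _) p]
    congr 1 with u
    by_cases hu : u ∈ ball (0 : ℂ) η
    · have hu' : p + u ∈ ball p η := by simpa using hu
      rw [indicator_of_mem hu, indicator_of_mem hu']
      rw [show p + u + (q - p) = q + u by ring]
      rfl
    · have hu' : p + u ∉ ball p η := by simpa using hu
      rw [indicator_of_notMem hu, indicator_of_notMem hu']
  · intro x hx t ht
    apply hp
    rw [mem_ball, dist_eq_norm] at *
    have h1 : ‖t • (q - p)‖ ≤ η := by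
      rw [norm_smul, Real.norm_of_nonneg ht.1, norm_sub_rev]
      nlinarith [ht.1, ht.2, norm_nonneg (p - q)]
    calc ‖x + t • (q - p) - p‖ = ‖(x - p) + t • (q - p)‖ := by congr 1; ring
      _ ≤ _ := norm_add_le _ _
      _ < 2 * η := by linarith

/-- The Poincaré inequality on a ball, with a non-optimal constant. -/
theorem lintegral_ball_sub_ballMean_sq_le {E : Set ℂ} {φ : ℂ → ℝ} {p : ℂ} {η : ℝ}
    (hη : 0 < η) (hE : IsOpen E) (hφ : ContDiffOn ℝ 1 φ E) (hmeas : Measurable φ)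
    (hint : IntegrableOn φ E) (hp : ball p η ⊆ E) :
    ∫⁻ x in ball p η, ‖φ x - ballMean φ η p‖ₑ ^ 2 ≤
      ENNReal.ofReal (16 * η ^ 2) * ∫⁻ x in E, ‖fderiv ℝ φ x‖ₑ ^ 2 := by
  set D := ∫⁻ x in E, ‖fderiv ℝ φ x‖ₑ ^ 2
  have hV0 : volume (ball (0 : ℂ) η) ≠ 0 := (measure_ball_pos _ _ hη).ne'
  have hV1 : volume (ball (0 : ℂ) η) ≠ ⊤ := measure_ball_lt_top.ne
  have ip := integrableOn_ball_zero_comp_add (hint.mono_set hp)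
  have hpt : ∀ x, ‖φ x - ballMean φ η p‖ₑ ^ 2 ≤
      (volume (ball (0 : ℂ) η))⁻¹ * ∫⁻ u in ball (0 : ℂ) η, ‖φ x - φ (p + u)‖ₑ ^ 2 := by
    intro x
    have hc : IntegrableOn (fun _ : ℂ => φ x) (ball 0 η) := integrableOn_const hV1
    have hx : φ x = (volume.real (ball (0 : ℂ) η))⁻¹ * ∫ u in ball (0 : ℂ) η, φ x := by
      rw [setIntegral_const, smul_eq_mul,
        inv_mul_cancel_left₀ (measureReal_ball_zero_pos hη).ne']
    conv_lhs => rw [hx]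
    rw [ballMean, ← mul_sub, ← integral_sub hc ip]
    exact enorm_inv_measureReal_mul_integral_sq_le hη (hc.sub ip).1
  have hdouble : ∫⁻ x in ball p η, ∫⁻ u in ball (0 : ℂ) η, ‖φ x - φ (p + u)‖ₑ ^ 2 ≤
      ENNReal.ofReal (2 * η) ^ 2 * D * volume (ball (0 : ℂ) (2 * η)) := by
    set F : ℂ → ℂ → ENNReal := fun x v =>
      (ball p η ∩ (fun x => x + v) ⁻¹' ball p η).indicator
        (fun x => ‖φ (x + v) - φ x‖ₑ ^ 2) x with hF
    have hFm : Measurable (Function.uncurry F) := by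
      have : Function.uncurry F = (Prod.fst ⁻¹' ball p η ∩
          (fun z : ℂ × ℂ => z.1 + z.2) ⁻¹' ball p η).indicator
            (fun z : ℂ × ℂ => ‖φ (z.1 + z.2) - φ z.1‖ₑ ^ 2) := by
        ext z
        simp only [Function.uncurry, F, indicator]
        rfl
      rw [this]
      refine Measurable.indicator (by fun_prop) ?_
      exact (measurableSet_ball.preimage measurable_fst).inter
        (measurableSet_ball.preimage (by fun_prop))
    calc ∫⁻ x in ball p η, ∫⁻ u in ball (0 : ℂ) η, ‖φ x - φ (p + u)‖ₑ ^ 2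
        = ∫⁻ x, ∫⁻ v, F x v := by
          rw [← lintegral_indicator measurableSet_ball]
          congr 1 with x
          by_cases hx : x ∈ ball p η
          · rw [indicator_of_mem hx, ← lintegral_indicator measurableSet_ball,
              ← lintegral_add_right_eq_self _ (x - p)]
            congr 1 with v
            have hv : v + (x - p) ∈ ball (0 : ℂ) η ↔ x + v ∈ ball p η := by
              simp only [mem_ball, dist_eq_norm]
              rw [show v + (x - p) - 0 = x + v - p by ring]
            by_cases h : x + v ∈ ball p η
            · rw [indicator_of_mem (hv.2 h), hF]
              simp only
              have hmem : x ∈ ball p η ∩ (fun x => x + v) ⁻¹' ball p η := ⟨hx, h⟩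
              rw [indicator_of_mem hmem, ← enorm_neg]
              congr 2
              rw [show p + (v + (x - p)) = x + v by ring]; ring
            · rw [indicator_of_notMem (fun h' => h (hv.1 h')), hF]
              simp only
              rw [indicator_of_notMem fun h' => h h'.2]
          · rw [indicator_of_notMem hx, hF]
            simp [hx]
      _ = ∫⁻ v, ∫⁻ x, F x v := lintegral_lintegral_swap hFm.aemeasurable
      _ ≤ ∫⁻ v, (ball (0 : ℂ) (2 * η)).indicator
            (fun _ => ENNReal.ofReal (2 * η) ^ 2 * D) v := by
          refine lintegral_mono fun v => ?_
          have hA : MeasurableSet (ball p η ∩ (fun x => x + v) ⁻¹' ball p η) :=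
            measurableSet_ball.inter (measurableSet_ball.preimage (by fun_prop))
          by_cases hv : v ∈ ball (0 : ℂ) (2 * η)
          · rw [indicator_of_mem hv, hF]
            simp only
            rw [lintegral_indicator hA]
            refine (lintegral_translate_sub_sq_le hE hφ ?_ hA).trans ?_
            · intro x hx t ht
              refine hp ?_
              have := (convex_ball p η).add_smul_sub_mem hx.1 hx.2 ht
              simpa using this
            · gcongr
              rw [← ofReal_norm]
              refine ENNReal.ofReal_le_ofReal ?_
              simpa using (mem_ball_zero_iff.1 hv).le
          · have : (ball p η ∩ (fun x => x + v) ⁻¹' ball p η) = ∅ := by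
              ext x
              simp only [mem_inter_iff, mem_preimage, mem_empty_iff_false, iff_false, not_and]
              intro h1 h2
              apply hv
              rw [mem_ball_zero_iff]
              rw [mem_ball, dist_eq_norm] at h1 h2
              calc ‖v‖ = ‖(x + v - p) - (x - p)‖ := by congr 1; ring
                _ ≤ _ := norm_sub_le _ _
                _ < 2 * η := by linarith
            rw [hF]
            simp only
            rw [this]
            simp
      _ = _ := by
          rw [lintegral_indicator measurableSet_ball, setLIntegral_const]
  calc ∫⁻ x in ball p η, ‖φ x - ballMean φ η p‖ₑ ^ 2
      ≤ ∫⁻ x in ball p η, (volume (ball (0 : ℂ) η))⁻¹ *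
          ∫⁻ u in ball (0 : ℂ) η, ‖φ x - φ (p + u)‖ₑ ^ 2 := lintegral_mono hpt
    _ = (volume (ball (0 : ℂ) η))⁻¹ *
          ∫⁻ x in ball p η, ∫⁻ u in ball (0 : ℂ) η, ‖φ x - φ (p + u)‖ₑ ^ 2 :=
        lintegral_const_mul' _ _ (ENNReal.inv_ne_top.2 hV0)
    _ ≤ (volume (ball (0 : ℂ) η))⁻¹ *
          (ENNReal.ofReal (2 * η) ^ 2 * D * volume (ball (0 : ℂ) (2 * η))) := by gcongr
    _ = ENNReal.ofReal (16 * η ^ 2) * D := by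
        have h2 : volume (ball (0 : ℂ) (2 * η)) = 4 * volume (ball (0 : ℂ) η) := by
          rw [Complex.volume_ball, Complex.volume_ball, ENNReal.ofReal_mul zero_le_two, mul_pow,
            mul_assoc]
          norm_num
        rw [h2, ← ENNReal.ofReal_pow (by positivity)]
        have h3 : ENNReal.ofReal (16 * η ^ 2) = 4 * ENNReal.ofReal ((2 * η) ^ 2) := by
          rw [← ENNReal.ofReal_ofNat, ← ENNReal.ofReal_mul (by norm_num)]
          congr 1; ring
        rw [h3]
        calc _ = ((volume (ball (0 : ℂ) η))⁻¹ * volume (ball (0 : ℂ) η)) *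
              (4 * ENNReal.ofReal ((2 * η) ^ 2) * D) := by ring
          _ = _ := by rw [ENNReal.inv_mul_cancel hV0 hV1, one_mul]

/-- A disk from which pairwise disjoint open disks have been removed is preconnected. -/
theorem isPreconnected_closedBall_diff_iUnion_ball {n : ℕ} {z₀ : ℂ} {R : ℝ} {z : Fin n → ℂ}
    {ρ : Fin n → ℝ} (hR : 0 < R) (hρ : ∀ i, 0 < ρ i)
    (hdisj : Pairwise fun i j => Disjoint (closedBall (z i) (ρ i)) (closedBall (z j) (ρ j)))
    (hsub : ∀ i, closedBall (z i) (ρ i) ⊆ ball z₀ R) :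
    IsPreconnected (closedBall z₀ R \ ⋃ i, ball (z i) (ρ i)) := by
  set S : Set ℂ := (range z)ᶜ
  have hS : IsPreconnected S :=
    ((finite_range z).countable.isConnected_compl_of_one_lt_rank
      (Complex.rank_real_complex ▸ Nat.one_lt_ofNat)).isPreconnected
  set F : ℂ → ℂ := fun x => x +
    (∑ i, (max (ρ i) ‖x - z i‖ / ‖x - z i‖ - 1) • (x - z i)) +
    (R / max R ‖x - z₀‖ - 1) • (x - z₀) with hF
  have hSz : ∀ x ∈ S, ∀ i, ‖x - z i‖ ≠ 0 := by
    intro x hx i h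
    exact hx ⟨i, (sub_eq_zero.1 (norm_eq_zero.1 h)).symm⟩
  have hFc : ContinuousOn F S := by
    refine ContinuousOn.add (ContinuousOn.add continuousOn_id ?_) ?_
    · refine continuousOn_finsetSum _ fun i _ => ?_
      have h1 : ContinuousOn (fun x => max (ρ i) ‖x - z i‖ / ‖x - z i‖) S :=
        ContinuousOn.div (by fun_prop) (by fun_prop) fun x hx => hSz x hx i
      exact (h1.sub continuousOn_const).smul (by fun_prop)
    · have h1 : Continuous fun x => R / max R ‖x - z₀‖ :=
        Continuous.div (by fun_prop) (by fun_prop) fun x => (lt_max_of_lt_left hR).ne'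
      exact ((h1.sub continuous_const).smul (by fun_prop)).continuousOn
  have hin : ∀ x ∈ S, ∀ i, ρ i ≤ ‖x - z i‖ →
      (max (ρ i) ‖x - z i‖ / ‖x - z i‖ - 1) • (x - z i) = 0 := by
    intro x hx i h
    rw [max_eq_right h, div_self (hSz x hx i), sub_self, zero_smul]
  have hout : ∀ x, ‖x - z₀‖ ≤ R → (R / max R ‖x - z₀‖ - 1) • (x - z₀) = 0 := by
    intro x h
    rw [max_eq_left h, div_self hR.ne', sub_self, zero_smul]
  have hGS : closedBall z₀ R \ ⋃ i, ball (z i) (ρ i) ⊆ S := by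
    rintro x ⟨-, hx⟩ ⟨i, rfl⟩
    exact hx (mem_iUnion.2 ⟨i, mem_ball_self (hρ i)⟩)
  have hFid : ∀ x ∈ closedBall z₀ R \ ⋃ i, ball (z i) (ρ i), F x = x := by
    intro x hx
    have h1 : ∀ i, ρ i ≤ ‖x - z i‖ := by
      intro i
      by_contra! h
      exact hx.2 (mem_iUnion.2 ⟨i, by rwa [mem_ball, dist_eq_norm]⟩)
    rw [hF]
    simp only
    rw [hout x (by simpa [dist_eq_norm] using hx.1),
      Finset.sum_eq_zero fun i _ => hin x (hGS hx) i (h1 i)]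
    simp
  have hFmaps : MapsTo F S (closedBall z₀ R \ ⋃ i, ball (z i) (ρ i)) := by
    intro x hx
    by_cases hx0 : ‖x - z₀‖ ≤ R
    · by_cases hxi : ∃ i, ‖x - z i‖ < ρ i
      · obtain ⟨i, hi⟩ := hxi
        have hj : ∀ j, j ≠ i → ρ j ≤ ‖x - z j‖ := by
          intro j hji
          by_contra! h
          exact Set.disjoint_left.1 (hdisj hji) (by rw [mem_closedBall, dist_eq_norm]; exact h.le)
            (by rw [mem_closedBall, dist_eq_norm]; exact hi.le)
        have hFx : F x - z i = (ρ i / ‖x - z i‖) • (x - z i) := by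
          rw [hF]
          simp only
          rw [hout x hx0, Finset.sum_eq_single i (fun j _ h => hin x hx j (hj j h)) (by simp),
            max_eq_left hi.le, sub_smul, one_smul]
          ring
        have hFn : dist (F x) (z i) = ρ i := by
          rw [dist_eq_norm, hFx, norm_smul, Real.norm_of_nonneg (by have := hρ i; positivity),
            div_mul_cancel₀ _ (hSz x hx i)]
        refine ⟨ball_subset_closedBall (hsub i (mem_closedBall.2 hFn.le)), ?_⟩
        rw [mem_iUnion]
        rintro ⟨j, hFj⟩
        by_cases hji : j = i
        · subst hji
          exact (mem_ball.1 hFj).ne hFn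
        · exact Set.disjoint_left.1 (hdisj hji) (ball_subset_closedBall hFj)
            (mem_closedBall.2 hFn.le)
      · push Not at hxi
        have hxG : x ∈ closedBall z₀ R \ ⋃ i, ball (z i) (ρ i) := by
          refine ⟨by rwa [mem_closedBall, dist_eq_norm], ?_⟩
          rw [mem_iUnion]
          rintro ⟨i, hi⟩
          rw [mem_ball, dist_eq_norm] at hi
          exact (hxi i).not_gt hi
        rwa [hFid x hxG]
    · push Not at hx0
      have hi : ∀ i, ρ i ≤ ‖x - z i‖ := by
        intro i
        by_contra! h
        have := hsub i (mem_closedBall.2 (by rw [dist_eq_norm]; exact h.le))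
        rw [mem_ball, dist_eq_norm] at this
        linarith
      have hFx : F x - z₀ = (R / ‖x - z₀‖) • (x - z₀) := by
        rw [hF]
        simp only
        rw [Finset.sum_eq_zero fun i _ => hin x hx i (hi i), max_eq_right hx0.le, sub_smul,
          one_smul]
        ring
      have hFn : dist (F x) z₀ = R := by
        rw [dist_eq_norm, hFx, norm_smul, Real.norm_of_nonneg (by positivity),
          div_mul_cancel₀ _ (hR.trans hx0).ne']
      refine ⟨mem_closedBall.2 hFn.le, ?_⟩
      rw [mem_iUnion]
      rintro ⟨j, hFj⟩
      exact (mem_ball.1 (hsub j (ball_subset_closedBall hFj))).ne hFn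
  have himage : F '' S = closedBall z₀ R \ ⋃ i, ball (z i) (ρ i) :=
    Subset.antisymm hFmaps.image_subset fun x hx => ⟨x, hGS hx, hFid x hx⟩
  rw [← himage]
  exact hS.image F hFc

/-- The total oscillation of a continuous function on a preconnected set is bounded by the number
of balls in a cover times the oscillation on each of them. -/
theorem abs_sub_le_card_mul_of_isPreconnected {X : Type*} [PseudoMetricSpace X] {G : Set X}
    {m : X → ℝ} {T : Finset X} {ε K : ℝ} (hG : IsPreconnected G) (hm : ContinuousOn m G)
    (hT : G ⊆ ⋃ t ∈ T, ball t ε) (hK : 0 ≤ K)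
    (hosc : ∀ p ∈ G, ∀ q ∈ G, dist p q < 2 * ε → |m p - m q| ≤ K) :
    ∀ p ∈ G, ∀ q ∈ G, |m p - m q| ≤ T.card * K := by
  have key : ∀ p ∈ G, ∀ q ∈ G, m q - m p ≤ T.card * K := by
    intro p hp q hq
    have hsub : Icc (m p) (m q) ⊆ ⋃ t ∈ T, m '' (G ∩ ball t ε) := by
      intro y hy
      obtain ⟨x, hx, rfl⟩ := (hG.image m hm).Icc_subset (mem_image_of_mem m hp)
        (mem_image_of_mem m hq) hy
      obtain ⟨t, ht, hxt⟩ := mem_iUnion₂.1 (hT hx)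
      exact mem_iUnion₂.2 ⟨t, ht, x, ⟨hx, hxt⟩, rfl⟩
    have hvol : ENNReal.ofReal (m q - m p) ≤ ENNReal.ofReal (T.card * K) := by
      calc ENNReal.ofReal (m q - m p) = volume (Icc (m p) (m q)) := Real.volume_Icc.symm
        _ ≤ ∑ t ∈ T, volume (m '' (G ∩ ball t ε)) :=
            (measure_mono hsub).trans (measure_biUnion_finset_le _ _)
        _ ≤ ∑ t ∈ T, ENNReal.ofReal K := by
            refine Finset.sum_le_sum fun t _ => (Real.volume_le_diam _).trans ?_
            refine ediam_le ?_
            rintro _ ⟨a, ha, rfl⟩ _ ⟨b, hb, rfl⟩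
            rw [edist_dist, Real.dist_eq]
            refine ENNReal.ofReal_le_ofReal (hosc a ha.1 b hb.1 ?_)
            have h1 := mem_ball.1 ha.2
            have h2 := mem_ball'.1 hb.2
            linarith [dist_triangle a t b]
        _ = ENNReal.ofReal (T.card * K) := by
            rw [Finset.sum_const, nsmul_eq_mul, ENNReal.ofReal_mul (by positivity),
              ENNReal.ofReal_natCast]
    exact (ENNReal.ofReal_le_ofReal_iff (by positivity)).1 hvol
  intro p hp q hq
  rw [abs_le]
  exact ⟨by linarith [key p hp q hq], key q hq p hp⟩

theorem ball_subset_perforated {n : ℕ} {z₀ p : ℂ} {z : Fin n → ℂ} {r₀ d : ℝ} {r : Fin n → ℝ}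
    (hp : p ∈ closedBall z₀ (r₀ - d) \ ⋃ i, ball (z i) (r i + d)) :
    ball p d ⊆ ball z₀ r₀ \ ⋃ i, closedBall (z i) (r i) := by
  intro x hx
  rw [mem_ball] at hx
  refine ⟨?_, ?_⟩
  · have := mem_closedBall.1 hp.1
    rw [mem_ball]
    linarith [dist_triangle x p z₀]
  · rw [mem_iUnion]
    rintro ⟨i, hi⟩
    refine hp.2 (mem_iUnion.2 ⟨i, ?_⟩)
    rw [mem_closedBall] at hi
    rw [mem_ball]
    linarith [dist_triangle p x (z i), dist_comm p x]

/-- Every point of a perforated disk has a neighbourhood that can be translated within the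
perforated disk to a place at a definite distance from the boundary. -/
theorem exists_translate_perforated {n : ℕ} {z₀ : ℂ} {z : Fin n → ℂ} {r₀ d : ℝ} {r : Fin n → ℝ}
    (hd : 0 < d) (hdr₀ : d < r₀) (hdr : ∀ i, d ≤ r i)
    (hdisj : Pairwise fun i j =>
      Disjoint (closedBall (z i) (r i + d)) (closedBall (z j) (r j + d)))
    (hsub : ∀ i, closedBall (z i) (r i + d) ⊆ ball z₀ (r₀ - d)) {x : ℂ}
    (hx : x ∈ ball z₀ r₀ \ ⋃ i, closedBall (z i) (r i)) :
    ∃ v : ℂ, ‖v‖ ≤ d / 4 ∧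
      x + v ∈ closedBall z₀ (r₀ - d / 4) \ ⋃ i, ball (z i) (r i + d / 4) ∧
      ∀ y ∈ ball z₀ r₀ \ ⋃ i, closedBall (z i) (r i), dist y x < d / 8 →
        ∀ t ∈ Icc (0 : ℝ) 1, y + t • v ∈ ball z₀ r₀ \ ⋃ i, closedBall (z i) (r i) := by
  have mem_outer : ∀ {y i}, dist y (z i) ≤ r i + d → dist y z₀ < r₀ - d :=
    fun {y i} h => hsub i h
  have far_outer : ∀ {y}, r₀ - d ≤ dist y z₀ → ∀ i, r i + d < dist y (z i) :=
    fun {y} h i => by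
      by_contra! h'
      exact (mem_outer h').not_ge h
  have far_other : ∀ {y i}, dist y (z i) ≤ r i + d → ∀ j, j ≠ i → r j + d < dist y (z j) :=
    fun {y i} h j hji => by
      by_contra! h'
      exact Set.disjoint_left.1 (hdisj hji) h' h
  have mem_E : ∀ {y}, y ∈ ball z₀ r₀ \ ⋃ i, closedBall (z i) (r i) ↔
      dist y z₀ < r₀ ∧ ∀ i, r i < dist y (z i) := by
    intro y; simp
  have mem_G : ∀ {y}, y ∈ closedBall z₀ (r₀ - d / 4) \ ⋃ i, ball (z i) (r i + d / 4) ↔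
      dist y z₀ ≤ r₀ - d / 4 ∧ ∀ i, r i + d / 4 ≤ dist y (z i) := by
    intro y; simp
  simp only [mem_E, mem_G] at hx ⊢
  have dist_shift : ∀ {x y w v : ℂ} {t : ℝ}, ‖v‖ ≤ d / 4 → dist y x < d / 8 → t ∈ Icc (0 : ℝ) 1 →
      |dist (y + t • v) w - dist x w| < d / 2 := by
    intro x y w v t hv hyx ht
    refine (abs_dist_sub_le _ _ _).trans_lt ?_
    rw [dist_eq_norm] at *
    have : ‖t • v‖ ≤ d / 4 := by
      rw [norm_smul, Real.norm_of_nonneg ht.1]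
      nlinarith [ht.1, ht.2, norm_nonneg v]
    calc ‖y + t • v - x‖ = ‖(y - x) + t • v‖ := by congr 1; ring
      _ ≤ _ := norm_add_le _ _
      _ < d / 2 := by linarith
  by_cases h0 : r₀ - d / 2 < dist x z₀
  · have hpos : 0 < ‖x - z₀‖ := by rw [← dist_eq_norm]; linarith
    set v : ℂ := -((d / 4 / ‖x - z₀‖) • (x - z₀)) with hv
    have hvn : ‖v‖ = d / 4 := by
      rw [hv, norm_neg, norm_smul, Real.norm_of_nonneg (by positivity), div_mul_cancel₀ _ hpos.ne']
    have hxv : dist (x + v) z₀ = dist x z₀ - d / 4 := by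
      have : x + v - z₀ = (1 - d / 4 / ‖x - z₀‖) • (x - z₀) := by
        rw [sub_smul, one_smul, hv]; ring
      rw [dist_eq_norm, this, norm_smul, dist_eq_norm, Real.norm_of_nonneg, sub_mul,
        div_mul_cancel₀ _ hpos.ne', one_mul]
      rw [sub_nonneg, div_le_one hpos, ← dist_eq_norm]
      linarith
    refine ⟨v, hvn.le, ⟨by linarith [hx.1], fun i => ?_⟩, fun y hy hyx t ht => ⟨?_, fun i => ?_⟩⟩
    · linarith [far_outer (y := x + v) (by linarith) i]
    · have h1 : y + v ∈ ball z₀ r₀ := by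
        have : dist (y + v) (x + v) = dist y x := dist_add_right _ _ _
        rw [mem_ball]
        linarith [dist_triangle (y + v) (x + v) z₀, hx.1]
      exact mem_ball.1 ((convex_ball z₀ r₀).add_smul_mem (mem_ball.2 hy.1) h1 ht)
    · have := (abs_lt.1 (dist_shift (w := z₀) hvn.le hyx ht)).1
      linarith [far_outer (y := y + t • v) (by linarith) i]
  · push Not at h0
    by_cases hi : ∃ i, dist x (z i) < r i + d / 2
    · obtain ⟨i, hi⟩ := hi
      have hxi := hx.2 i
      have hri := hdr i
      have hpos : 0 < ‖x - z i‖ := by rw [← dist_eq_norm]; linarith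
      set v : ℂ := (d / 4 / ‖x - z i‖) • (x - z i) with hv
      have hvn : ‖v‖ = d / 4 := by
        rw [hv, norm_smul, Real.norm_of_nonneg (by positivity), div_mul_cancel₀ _ hpos.ne']
      have hxv : dist (x + v) (z i) = dist x (z i) + d / 4 := by
        have : x + v - z i = (1 + d / 4 / ‖x - z i‖) • (x - z i) := by
          rw [add_smul, one_smul, hv]; ring
        rw [dist_eq_norm, this, norm_smul, dist_eq_norm, Real.norm_of_nonneg (by positivity),
          add_mul, div_mul_cancel₀ _ hpos.ne', one_mul]
      refine ⟨v, hvn.le, ⟨?_, fun j => ?_⟩, fun y hy hyx t ht => ?_⟩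
      · linarith [mem_outer (y := x + v) (i := i) (by linarith)]
      · by_cases hji : j = i
        · subst hji; linarith
        · linarith [far_other (y := x + v) (i := i) (by linarith) j hji]
      · have hle : dist (y + t • v) (z i) ≤ r i + d := by
          linarith [(abs_lt.1 (dist_shift (w := z i) hvn.le hyx ht)).2]
        refine ⟨by linarith [mem_outer hle], fun j => ?_⟩
        by_cases hji : j = i
        · subst hji
          have hyj := hy.2 j
          set s : ℝ := t * (d / 4 / ‖x - z j‖) with hs
          have hs0 : 0 ≤ s := mul_nonneg ht.1 (by positivity)
          have hdec : (1 + s) • (y - z j) = (y + t • v - z j) + s • (y - x) := by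
            rw [hv, smul_smul, ← hs]
            simp only [Complex.real_smul]
            push_cast
            ring
          have hn := norm_add_le (y + t • v - z j) (s • (y - x))
          rw [← hdec, norm_smul, norm_smul, Real.norm_of_nonneg hs0,
            Real.norm_of_nonneg (by positivity), ← dist_eq_norm, ← dist_eq_norm,
            ← dist_eq_norm] at hn
          nlinarith
        · linarith [far_other hle j hji]
    · push Not at hi
      refine ⟨0, by simp; linarith, ⟨by rw [add_zero]; linarith, fun i => ?_⟩,
        fun y hy _ t _ => by simpa using hy⟩
      rw [add_zero]
      linarith [hi i]

theorem lintegral_biUnion_finset_le_sum {α ι : Type*} [MeasurableSpace α] {μ : Measure α}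
    (T : Finset ι) (s : ι → Set α) (f : α → ENNReal) :
    ∫⁻ x in ⋃ t ∈ T, s t, f x ∂μ ≤ ∑ t ∈ T, ∫⁻ x in s t, f x ∂μ := by
  classical
  induction T using Finset.induction_on with
  | empty => simp
  | insert t T ht ih =>
    rw [Finset.set_biUnion_insert, Finset.sum_insert ht]
    exact (lintegral_union_le _ _ _).trans (by gcongr)

theorem enorm_sq_eq_ofReal (a : ℝ) : ‖a‖ₑ ^ 2 = ENNReal.ofReal (a ^ 2) := by
  rw [Real.enorm_eq_ofReal_abs, ← ENNReal.ofReal_pow (abs_nonneg a), sq_abs]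

theorem setIntegral_sq_le_setIntegral_sub_sq {E : Set ℂ} {φ : ℂ → ℝ} (hE : volume E ≠ ⊤)
    (hint : IntegrableOn φ E) (hint2 : IntegrableOn (fun x => φ x ^ 2) E)
    (hmean : ∫ x in E, φ x = 0) (c : ℝ) :
    IntegrableOn (fun x => (φ x - c) ^ 2) E ∧
      ∫ x in E, φ x ^ 2 ≤ ∫ x in E, (φ x - c) ^ 2 := by
  have hc : IntegrableOn (fun _ : ℂ => c ^ 2) E := integrableOn_const hE
  have hexp : (fun x => (φ x - c) ^ 2) = fun x => φ x ^ 2 - 2 * c * φ x + c ^ 2 := by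
    ext x; ring
  have h1 : IntegrableOn (fun x => φ x ^ 2 - 2 * c * φ x) E := hint2.sub (hint.const_mul _)
  rw [hexp]
  refine ⟨h1.add hc, ?_⟩
  rw [integral_add h1 hc, integral_sub hint2 (hint.const_mul _), integral_const_mul, hmean,
    setIntegral_const, smul_eq_mul]
  have : 0 ≤ volume.real E * c ^ 2 := by positivity
  linarith

/-- The Poincaré inequality on a perforated disk, with a constant given by the number of balls of
radius `d / 16` that are needed to cover the disk. -/
theorem setIntegral_sq_le_perforated {n : ℕ} {z₀ : ℂ} {z : Fin n → ℂ} {r₀ d : ℝ} {r : Fin n → ℝ}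
    {T : Finset ℂ} {φ : ℂ → ℝ} {E : Set ℂ}
    (hd : 0 < d) (hdr₀ : d < r₀) (hdr : ∀ i, d ≤ r i)
    (hdisj : Pairwise fun i j =>
      Disjoint (closedBall (z i) (r i + d)) (closedBall (z j) (r j + d)))
    (hsub : ∀ i, closedBall (z i) (r i + d) ⊆ ball z₀ (r₀ - d))
    (hT : ball z₀ r₀ ⊆ ⋃ t ∈ T, ball t (d / 16))
    (hEdef : E = ball z₀ r₀ \ ⋃ i, closedBall (z i) (r i))
    (hφ : ContDiffOn ℝ 1 φ E) (hmeas : Measurable φ)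
    (hint2 : IntegrableOn (fun x => φ x ^ 2) E)
    (henergy : ∫⁻ x in E, ‖fderiv ℝ φ x‖ₑ ^ 2 = 1) (hmean : ∫ x in E, φ x = 0) :
    ∫ x in E, φ x ^ 2 ≤ T.card * (1 + 3 * T.card ^ 2) * d ^ 2 := by
  set N : ℝ := (T.card : ℝ)
  have hN : 0 ≤ N := Nat.cast_nonneg _
  have hE : IsOpen E := by
    rw [hEdef]
    exact isOpen_ball.sdiff (isClosed_iUnion_of_finite fun i => isClosed_closedBall)
  have hEr₀ : E ⊆ ball z₀ r₀ := hEdef ▸ sdiff_subset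
  have hEfin : volume E ≠ ⊤ := measure_ne_top_of_subset hEr₀ measure_ball_lt_top.ne
  have hint : IntegrableOn φ E := by
    have : IsFiniteMeasure (volume.restrict E) := ⟨by
      rw [Measure.restrict_apply_univ]; exact hEfin.lt_top⟩
    exact ((memLp_two_iff_integrable_sq hmeas.aestronglyMeasurable).2 hint2).integrable
      one_le_two
  set η : ℝ := d / 8 with hη
  have hη0 : 0 < η := by positivity
  set G : Set ℂ := closedBall z₀ (r₀ - d / 4) \ ⋃ i, ball (z i) (r i + d / 4)
  have hG : IsPreconnected G := by
    refine isPreconnected_closedBall_diff_iUnion_ball (by linarith)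
      (fun i => by linarith [hdr i]) (fun i j hij => ?_) fun i => ?_
    · exact (hdisj hij).mono (closedBall_subset_closedBall (by linarith))
        (closedBall_subset_closedBall (by linarith))
    · exact (closedBall_subset_closedBall (by linarith)).trans
        ((hsub i).trans (ball_subset_ball (by linarith)))
  have hGE : ∀ p ∈ G, ball p (2 * η) ⊆ E := by
    intro p hp
    rw [hEdef, show 2 * η = d / 4 by rw [hη]; ring]
    exact ball_subset_perforated hp
  have hlip : ∀ p ∈ G, ∀ q, dist p q ≤ η →
      |ballMean φ η q - ballMean φ η p| ≤ η⁻¹ * dist q p := by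
    intro p hp q hpq
    have h := enorm_ballMean_sub_ballMean_sq_le hη0 hE hφ hint (hGE p hp) hpq
    have hVfin : volume (ball (0 : ℂ) η) = ENNReal.ofReal (η ^ 2 * Real.pi) := by
      rw [Complex.volume_ball, ENNReal.ofReal_mul (by positivity),
        ENNReal.ofReal_pow hη0.le]
      congr 1
      exact (ENNReal.ofReal_coe_nnreal (p := NNReal.pi)).symm
    rw [henergy, mul_one, enorm_sq_eq_ofReal, hVfin, ← ENNReal.ofReal_inv_of_pos (by positivity),
      ← ofReal_norm, ← ENNReal.ofReal_pow (norm_nonneg _), ← ENNReal.ofReal_mul (by positivity),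
      ENNReal.ofReal_le_ofReal_iff (by positivity), ← dist_eq_norm] at h
    refine abs_le_of_sq_le_sq (h.trans ?_) (by positivity)
    rw [mul_pow, inv_pow]
    gcongr
    nlinarith [Real.pi_gt_three, sq_nonneg η]
  have hcont : ContinuousOn (ballMean φ η) G := by
    intro p hp
    refine ContinuousAt.continuousWithinAt ?_
    exact continuousAt_of_locally_lipschitz hη0 η⁻¹ fun q hq => by
      rw [Real.dist_eq]
      exact hlip p hp q (by rw [dist_comm]; exact hq.le)
  have hGT : G ⊆ ⋃ t ∈ T, ball t (d / 16) := fun p hp =>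
    hT (hEr₀ (hGE p hp (mem_ball_self (by positivity))))
  have hosc : ∀ p ∈ G, ∀ q ∈ G, |ballMean φ η p - ballMean φ η q| ≤ N * 1 := by
    refine abs_sub_le_card_mul_of_isPreconnected hG hcont hGT zero_le_one fun p hp q hq hpq => ?_
    have hle : dist p q ≤ η := by rw [hη]; linarith
    refine (hlip q hq p (by rwa [dist_comm])).trans ?_
    rwa [inv_mul_le_iff₀ hη0, mul_one]
  obtain ⟨c, hc⟩ : ∃ c, ∀ p ∈ G, |ballMean φ η p - c| ≤ N := by
    rcases G.eq_empty_or_nonempty with h | ⟨p₀, hp₀⟩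
    · exact ⟨0, by simp [h]⟩
    · exact ⟨ballMean φ η p₀, fun p hp => (hosc p hp p₀ hp₀).trans_eq (mul_one N)⟩
  have hpatch : ∀ t ∈ T, ∫⁻ x in E ∩ ball t (d / 16), ‖φ x - c‖ₑ ^ 2 ≤
      ENNReal.ofReal ((1 + 3 * N ^ 2) * d ^ 2) := by
    intro t _
    rcases (E ∩ ball t (d / 16)).eq_empty_or_nonempty with h | ⟨x, hxE, hxt⟩
    · simp [h]
    obtain ⟨v, hv, hxv, hmove⟩ := exists_translate_perforated hd hdr₀ hdr hdisj hsub
      (hEdef ▸ hxE)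
    rw [← hEdef] at hmove
    have hnear : ∀ y ∈ E ∩ ball t (d / 16), dist y x < d / 8 := fun y hy => by
      linarith [dist_triangle_right y x t, mem_ball.1 hy.2, mem_ball.1 hxt]
    set A := E ∩ ball t (d / 16)
    have hA : MeasurableSet A := hE.measurableSet.inter measurableSet_ball
    have h1 : ∫⁻ y in A, ‖φ (y + v) - φ y‖ₑ ^ 2 ≤ ENNReal.ofReal (d ^ 2 / 16) := by
      refine (lintegral_translate_sub_sq_le hE hφ
        (fun y hy s hs => hmove y hy.1 (hnear y hy) s hs) hA).trans ?_
      rw [henergy, mul_one, ← ofReal_norm, ← ENNReal.ofReal_pow (norm_nonneg _)]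
      refine ENNReal.ofReal_le_ofReal ?_
      nlinarith [norm_nonneg v]
    have h2 : ∫⁻ y in A, ‖φ (y + v) - ballMean φ η (x + v)‖ₑ ^ 2 ≤
        ENNReal.ofReal (d ^ 2 / 4) := by
      refine le_trans ?_ ((lintegral_ball_sub_ballMean_sq_le hη0 hE hφ hmeas hint
        ((ball_subset_ball (by linarith)).trans (hGE _ hxv))).trans_eq ?_)
      · rw [← lintegral_indicator hA, ← lintegral_indicator measurableSet_ball,
          ← lintegral_add_right_eq_self ((ball (x + v) η).indicator _) v]
        refine lintegral_mono fun y => ?_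
        by_cases hy : y ∈ A
        · have hyv : y + v ∈ ball (x + v) η := by
            rw [mem_ball, dist_add_right]
            exact hnear y hy
          rw [indicator_of_mem hy, indicator_of_mem hyv]
        · rw [indicator_of_notMem hy]
          exact zero_le
      · rw [henergy, mul_one]
        congr 1
        rw [hη]; ring
    have h3 : ∫⁻ y in A, ‖ballMean φ η (x + v) - c‖ₑ ^ 2 ≤
        ENNReal.ofReal (N ^ 2 * (d ^ 2 / 64)) := by
      rw [setLIntegral_const, enorm_sq_eq_ofReal,
        ENNReal.ofReal_mul (by positivity : (0 : ℝ) ≤ N ^ 2)]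
      refine mul_le_mul' (ENNReal.ofReal_le_ofReal ?_) ?_
      · rw [← sq_abs]
        exact pow_le_pow_left₀ (abs_nonneg _) (hc _ hxv) 2
      · refine (measure_mono inter_subset_right).trans ?_
        rw [Complex.volume_ball, ← ENNReal.ofReal_pow (by positivity),
          ← ENNReal.ofReal_coe_nnreal (p := NNReal.pi), NNReal.coe_real_pi,
          ← ENNReal.ofReal_mul (by positivity)]
        refine ENNReal.ofReal_le_ofReal ?_
        nlinarith [Real.pi_le_four, sq_nonneg d]
    calc ∫⁻ y in A, ‖φ y - c‖ₑ ^ 2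
        ≤ ∫⁻ y in A, 3 * (‖φ (y + v) - φ y‖ₑ ^ 2 +
            ‖φ (y + v) - ballMean φ η (x + v)‖ₑ ^ 2 +
            ‖ballMean φ η (x + v) - c‖ₑ ^ 2) := by
          refine lintegral_mono fun y => ?_
          simp only [enorm_sq_eq_ofReal]
          rw [← ENNReal.ofReal_add (by positivity) (by positivity),
            ← ENNReal.ofReal_add (by positivity) (by positivity), ← ENNReal.ofReal_ofNat,
            ← ENNReal.ofReal_mul (by positivity)]
          refine ENNReal.ofReal_le_ofReal ?_
          set a := φ (y + v)
          set b := ballMean φ η (x + v)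
          nlinarith [sq_nonneg ((a - φ y) + (a - b)), sq_nonneg ((a - φ y) + (b - c)),
            sq_nonneg ((a - b) - (b - c))]
      _ = 3 * ((∫⁻ y in A, ‖φ (y + v) - φ y‖ₑ ^ 2) +
            (∫⁻ y in A, ‖φ (y + v) - ballMean φ η (x + v)‖ₑ ^ 2) +
            ∫⁻ y in A, ‖ballMean φ η (x + v) - c‖ₑ ^ 2) := by
          rw [lintegral_const_mul' _ _ (by simp), lintegral_add_right _ (by fun_prop),
            lintegral_add_right _ (by fun_prop)]
      _ ≤ 3 * (ENNReal.ofReal (d ^ 2 / 16) + ENNReal.ofReal (d ^ 2 / 4) +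
            ENNReal.ofReal (N ^ 2 * (d ^ 2 / 64))) := by gcongr
      _ ≤ _ := by
          rw [← ENNReal.ofReal_add (by positivity) (by positivity),
            ← ENNReal.ofReal_add (by positivity) (by positivity), ← ENNReal.ofReal_ofNat,
            ← ENNReal.ofReal_mul (by positivity)]
          refine ENNReal.ofReal_le_ofReal ?_
          nlinarith [sq_nonneg d, mul_nonneg (sq_nonneg N) (sq_nonneg d)]
  have htotal : ∫⁻ x in E, ‖φ x - c‖ₑ ^ 2 ≤
      ENNReal.ofReal (N * (1 + 3 * N ^ 2) * d ^ 2) := by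
    calc ∫⁻ x in E, ‖φ x - c‖ₑ ^ 2
        ≤ ∫⁻ x in ⋃ t ∈ T, E ∩ ball t (d / 16), ‖φ x - c‖ₑ ^ 2 := by
          refine lintegral_mono_set fun x hx => ?_
          obtain ⟨t, ht, hxt⟩ := mem_iUnion₂.1 (hT (hEr₀ hx))
          exact mem_iUnion₂.2 ⟨t, ht, hx, hxt⟩
      _ ≤ ∑ t ∈ T, ∫⁻ x in E ∩ ball t (d / 16), ‖φ x - c‖ₑ ^ 2 :=
          lintegral_biUnion_finset_le_sum T _ _
      _ ≤ ∑ t ∈ T, ENNReal.ofReal ((1 + 3 * N ^ 2) * d ^ 2) := Finset.sum_le_sum hpatch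
      _ = _ := by
          rw [Finset.sum_const, nsmul_eq_mul, mul_assoc, ENNReal.ofReal_mul hN,
            ENNReal.ofReal_natCast]
  obtain ⟨hi, hle⟩ := setIntegral_sq_le_setIntegral_sub_sq hEfin hint hint2 hmean c
  refine hle.trans ?_
  rw [← ENNReal.ofReal_le_ofReal_iff (by positivity),
    ofReal_integral_eq_lintegral_ofReal hi (.of_forall fun x => sq_nonneg _)]
  simpa only [enorm_sq_eq_ofReal] using htotal

theorem stmt_4 (δ : ℝ) (hδ0 : 0 < δ) (hδ1 : δ < 1) :
    ∃ C : ℝ, 0 < C ∧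
      ∀ (n : ℕ) (z₀ : ℂ) (z : Fin n → ℂ) (r₀ d : ℝ) (r : Fin n → ℝ),
        0 < r₀ → 0 < d → δ ≤ d / r₀ → (∀ i, d ≤ r i) →
        (Pairwise (fun i j =>
          Disjoint (Metric.closedBall (z i) (r i + d)) (Metric.closedBall (z j) (r j + d)))) →
        (∀ i, Metric.closedBall (z i) (r i + d) ⊆ Metric.ball z₀ (r₀ - d)) →
        ∀ φ : ℂ → ℝ,
          ContDiffOn ℝ 1 φ (Metric.ball z₀ r₀ \ ⋃ i, Metric.closedBall (z i) (r i)) →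
          MeasureTheory.IntegrableOn (fun x => φ x ^ 2)
            (Metric.ball z₀ r₀ \ ⋃ i, Metric.closedBall (z i) (r i)) →
          MeasureTheory.IntegrableOn (fun x => ‖fderiv ℝ φ x‖ ^ 2)
            (Metric.ball z₀ r₀ \ ⋃ i, Metric.closedBall (z i) (r i)) →
          (∫ x in Metric.ball z₀ r₀ \ ⋃ i, Metric.closedBall (z i) (r i),
            ‖fderiv ℝ φ x‖ ^ 2) = 1 →
          (∫ x in Metric.ball z₀ r₀ \ ⋃ i, Metric.closedBall (z i) (r i), φ x) = 0 →
          (∫ x in Metric.ball z₀ r₀ \ ⋃ i, Metric.closedBall (z i) (r i), φ x ^ 2) ≤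
            C ^ 2 * r₀ ^ 2 := by
  obtain ⟨T, -, hTfin, hTcover⟩ := (isCompact_closedBall (0 : ℂ) 1).finite_cover_balls
    (e := δ / 16) (by positivity)
  set T₁ : Finset ℂ := hTfin.toFinset
  set N : ℝ := (T₁.card : ℝ)
  have hN : 0 ≤ N := Nat.cast_nonneg _
  refine ⟨1 + N * (1 + 3 * N ^ 2), by positivity, ?_⟩
  intro n z₀ z r₀ d r hr₀ hd hδd hdr hdisj hsub φ hφ hint2 hgrad henergy hmean
  set E : Set ℂ := ball z₀ r₀ \ ⋃ i, closedBall (z i) (r i) with hEdef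
  have hE : IsOpen E :=
    isOpen_ball.sdiff (isClosed_iUnion_of_finite fun i => isClosed_closedBall)
  have hEm : MeasurableSet E := hE.measurableSet
  have hδr₀ : δ * r₀ ≤ d := (le_div_iff₀ hr₀).1 hδd
  set T₂ : Finset ℂ := T₁.image fun t => z₀ + r₀ • t
  have hT₂ : ball z₀ r₀ ⊆ ⋃ t ∈ T₂, ball t (δ * r₀ / 16) := by
    intro x hx
    have hx' : r₀⁻¹ • (x - z₀) ∈ closedBall (0 : ℂ) 1 := by
      rw [mem_closedBall_zero_iff, norm_smul, norm_inv, Real.norm_of_nonneg hr₀.le,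
        ← dist_eq_norm, inv_mul_le_iff₀ hr₀, mul_one]
      exact (mem_ball.1 hx).le
    obtain ⟨t, ht, hxt⟩ := mem_iUnion₂.1 (hTcover hx')
    refine mem_iUnion₂.2 ⟨z₀ + r₀ • t,
      Finset.mem_image_of_mem _ (hTfin.mem_toFinset.2 ht), ?_⟩
    rw [mem_ball, dist_eq_norm] at hxt ⊢
    have : x - (z₀ + r₀ • t) = r₀ • (r₀⁻¹ • (x - z₀) - t) := by
      rw [smul_sub, smul_inv_smul₀ hr₀.ne']; ring
    rw [this, norm_smul, Real.norm_of_nonneg hr₀.le]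
    nlinarith
  set ψ : ℂ → ℝ := E.indicator φ
  have hψφ : EqOn ψ φ E := fun x hx => indicator_of_mem hx φ
  have hψm : Measurable ψ := by
    classical
    rw [show ψ = E.piecewise φ 0 from (piecewise_eq_indicator).symm]
    exact hφ.continuousOn.measurable_piecewise continuousOn_const hEm
  have hfderiv : ∀ x ∈ E, fderiv ℝ ψ x = fderiv ℝ φ x := fun x hx =>
    (hψφ.eventuallyEq_of_mem (hE.mem_nhds hx)).fderiv_eq
  have hψenergy : ∫⁻ x in E, ‖fderiv ℝ ψ x‖ₑ ^ 2 = 1 := by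
    rw [setLIntegral_congr_fun (g := fun x => ENNReal.ofReal (‖fderiv ℝ φ x‖ ^ 2)) hEm,
      ← ofReal_integral_eq_lintegral_ofReal hgrad (.of_forall fun x => sq_nonneg _), henergy,
      ENNReal.ofReal_one]
    intro x hx
    simp only
    rw [hfderiv x hx, ← ofReal_norm, ENNReal.ofReal_pow (norm_nonneg _)]
  have hψsq : EqOn (fun x => ψ x ^ 2) (fun x => φ x ^ 2) E := fun x hx => by
    simp only [hψφ hx]
  have hmain := setIntegral_sq_le_perforated (d := δ * r₀) (T := T₂) (E := E) (φ := ψ)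
    (by positivity) (by nlinarith) (fun i => hδr₀.trans (hdr i))
    (fun i j hij => (hdisj hij).mono (closedBall_subset_closedBall (by linarith))
      (closedBall_subset_closedBall (by linarith)))
    (fun i => (closedBall_subset_closedBall (by linarith)).trans
      ((hsub i).trans (ball_subset_ball (by linarith))))
    hT₂ hEdef (hφ.congr hψφ) hψm (hint2.congr_fun hψsq.symm hEm) hψenergy
    ((setIntegral_congr_fun hEm hψφ).trans hmean)
  rw [setIntegral_congr_fun hEm hψsq] at hmain
  refine hmain.trans ?_
  have hcard : (T₂.card : ℝ) ≤ N := Nat.cast_le.2 Finset.card_image_le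
  calc (T₂.card : ℝ) * (1 + 3 * (T₂.card : ℝ) ^ 2) * (δ * r₀) ^ 2
      ≤ N * (1 + 3 * N ^ 2) * (1 * r₀) ^ 2 := by gcongr
    _ ≤ (1 + N * (1 + 3 * N ^ 2)) ^ 2 * r₀ ^ 2 := by
        rw [one_mul]
        have : 0 ≤ N * (1 + 3 * N ^ 2) := by positivity
        gcongr
        nlinarith
end

section
/- Let 0 < ρ₁ < ρ₂ and let A = B_{ρ₂}(0) ∖ B̄_{ρ₁}(0) ⊂ ℝ². Let φ be a continuously differentiable real-valued function on the closed annulus Ā. Then for each i ∈ {1,2}: ∫_{∂B_{ρᵢ}(0)} φ² dS ≤ (8/(ρ₂ − ρ₁)) ∫_A φ² dx + 4(ρ₂ − ρ₁) ∫_A |Dφ|² dx, where dS denotes integration with respect to arclength (one-dimensional Hausdorff measure) on the circle ∂B_{ρᵢ}(0). -/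
open Set MeasureTheory Metric Topology in
/-- A function which is `C¹` on a compact set has bounded derivative on its interior. -/
lemma IsCompact.exists_norm_fderiv_le_of_contDiffOn {E F : Type*}
    [NormedAddCommGroup E] [NormedSpace ℝ E] [NormedAddCommGroup F] [NormedSpace ℝ F]
    {s : Set E} (hs : IsCompact s) {f : E → F} (hf : ContDiffOn ℝ 1 f s) :
    ∃ C, ∀ y ∈ interior s, ‖fderiv ℝ f y‖ ≤ C := by
  suffices h : ∃ C, ∀ y ∈ s, y ∈ interior s → ‖fderiv ℝ f y‖ ≤ C by
    obtain ⟨C, hC⟩ := h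
    exact ⟨C, fun y hy ↦ hC y (interior_subset hy) hy⟩
  refine hs.induction_on (p := fun t ↦ ∃ C, ∀ y ∈ t, y ∈ interior s → ‖fderiv ℝ f y‖ ≤ C)
    ⟨0, by simp⟩ ?_ ?_ ?_
  · rintro t u htu ⟨C, hC⟩
    exact ⟨C, fun y hy ↦ hC y (htu hy)⟩
  · rintro t u ⟨C, hC⟩ ⟨D, hD⟩
    refine ⟨max C D, ?_⟩
    rintro y (hy | hy) hys
    · exact (hC y hy hys).trans (le_max_left _ _)
    · exact (hD y hy hys).trans (le_max_right _ _)
  · intro x hx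
    have hfx : ContDiffWithinAt ℝ (0 + 1) f s x := by simpa using hf x hx
    obtain ⟨u, hu, -, -, f', hf', hcont⟩ :=
      (contDiffWithinAt_succ_iff_hasFDerivWithinAt' (by simp)).1 hfx
    rw [insert_eq_of_mem hx] at hu
    have hbound : ∀ᶠ y in 𝓝[s] x, ‖f' y‖ < ‖f' x‖ + 1 :=
      hcont.continuousWithinAt.norm.eventually_lt_const (lt_add_one _)
    refine ⟨_, Filter.inter_mem hu hbound, ‖f' x‖ + 1, ?_⟩
    rintro y ⟨hyu, hy⟩ hys
    rw [((hf' y hyu).hasFDerivAt (mem_interior_iff_mem_nhds.1 hys)).fderiv]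
    exact le_of_lt hy

open Set MeasureTheory in
/-- Weighted one-dimensional trace inequality at both ends of an interval. -/
lemma trace_sq_le_setIntegral {a b : ℝ} (ha : 0 < a) (hab : a < b) {u g : ℝ → ℝ}
    (hu : ContinuousOn u (Icc a b))
    (hd : ∀ r ∈ Ioo a b, ∃ u', HasDerivAt u u' r ∧ |u'| ≤ g r)
    (hint : IntegrableOn
      (fun r ↦ r * (8 / (b - a) * u r ^ 2 + 4 * (b - a) * g r ^ 2)) (Ioo a b)) :
    ∀ c ∈ ({a, b} : Set ℝ), u c ^ 2 * c ≤
      ∫ r in Ioo a b, r * (8 / (b - a) * u r ^ 2 + 4 * (b - a) * g r ^ 2) := by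
  have hba : 0 < b - a := sub_pos.2 hab
  have key : ∀ r ∈ Ioo a b, ∀ v, |v| ≤ g r → ∀ t, 0 ≤ t → t ≤ 1 →
      2 * t * |u r * v| ≤ 1 / (b - a) * u r ^ 2 + (b - a) * g r ^ 2 := by
    intro r hr v hv t ht ht1
    have h1 : |v| ^ 2 ≤ g r ^ 2 := by gcongr
    have h2 : 2 * (|u r| * |v|) ≤ 1 / (b - a) * |u r| ^ 2 + (b - a) * |v| ^ 2 := by
      have h3 : 1 / (b - a) * |u r| ^ 2 + (b - a) * |v| ^ 2 - 2 * (|u r| * |v|)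
          = 1 / (b - a) * (|u r| - (b - a) * |v|) ^ 2 := by
        field_simp
        ring
      have h4 : 0 ≤ 1 / (b - a) * (|u r| - (b - a) * |v|) ^ 2 := by positivity
      linarith
    rw [abs_mul]
    have h5 : t * (|u r| * |v|) ≤ 1 * (|u r| * |v|) := by gcongr
    have h6 : (b - a) * |v| ^ 2 ≤ (b - a) * g r ^ 2 := by gcongr
    rw [sq_abs (u r)] at h2
    linarith
  choose! u' hu' hg using hd
  have hint' := (integrableOn_Icc_iff_integrableOn_Ioo enorm_ne_top enorm_ne_top).2 hint
  rw [← integral_Ioc_eq_integral_Ioo, ← intervalIntegral.integral_of_le hab.le]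
  rintro c (rfl | rfl)
  · have := intervalIntegral.sub_le_integral_of_hasDeriv_right_of_le hab.le
      (g := fun r ↦ -(c * ((b - r) / (b - c)) * u r ^ 2))
      (g' := fun r ↦ -(c * (-1 / (b - c)) * u r ^ 2 + c * ((b - r) / (b - c)) * (2 * u r * u' r)))
      (by fun_prop) ?_ hint' ?_
    · refine le_trans (le_of_eq ?_) this
      field_simp
      ring
    · intro r hr
      have h1 := (((((hasDerivAt_id r).const_sub b).div_const (b - c)).const_mul c).mul
        ((hu' r hr).pow 2)).neg
      refine (h1.congr_deriv ?_).hasDerivWithinAt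
      simp
    · intro r hr
      have ht : 0 ≤ (b - r) / (b - c) := div_nonneg (by linarith [hr.2]) hba.le
      have ht1 : (b - r) / (b - c) ≤ 1 := (div_le_one hba).2 (by linarith [hr.1])
      have h1 := key r hr _ (hg r hr) _ ht ht1
      have h2 : -(u r * u' r) ≤ |u r * u' r| := neg_le_abs _
      set t := (b - r) / (b - c)
      have h3 : t * -(u r * u' r) ≤ t * |u r * u' r| := by gcongr
      have h0 : 0 ≤ 1 / (b - c) * u r ^ 2 := by positivity
      have h0' : 0 ≤ (b - c) * g r ^ 2 := by positivity
      have h4 : -(c * (-1 / (b - c)) * u r ^ 2 + c * t * (2 * u r * u' r))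
          = c * (1 / (b - c) * u r ^ 2 + 2 * (t * -(u r * u' r))) := by ring
      rw [h4]
      have h5 : 8 / (b - c) * u r ^ 2 = 8 * (1 / (b - c) * u r ^ 2) := by ring
      rw [h5]
      calc _ ≤ c * (8 * (1 / (b - c) * u r ^ 2) + 4 * (b - c) * g r ^ 2) := by
            refine mul_le_mul_of_nonneg_left ?_ ha.le; linarith
        _ ≤ _ := by gcongr; exact hr.1.le
  · have := intervalIntegral.sub_le_integral_of_hasDeriv_right_of_le hab.le
      (g := fun r ↦ r * ((r - a) / (c - a)) * u r ^ 2)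
      (g' := fun r ↦ ((r - a) / (c - a) + r * (1 / (c - a))) * u r ^ 2
        + r * ((r - a) / (c - a)) * (2 * u r * u' r))
      (by fun_prop) ?_ hint' ?_
    · refine le_trans (le_of_eq ?_) this
      field_simp
      ring
    · intro r hr
      have h1 := (((hasDerivAt_id r).mul
        (((hasDerivAt_id r).sub_const a).div_const (c - a))).mul ((hu' r hr).pow 2))
      refine (h1.congr_deriv ?_).hasDerivWithinAt
      simp
    · intro r hr
      have hr0 : 0 < r := ha.trans hr.1
      have ht : 0 ≤ (r - a) / (c - a) := div_nonneg (by linarith [hr.1]) hba.le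
      have ht1 : (r - a) / (c - a) ≤ 1 := (div_le_one hba).2 (by linarith [hr.2])
      have ht2 : (r - a) / (c - a) ≤ r * (1 / (c - a)) := by
        rw [mul_one_div]; gcongr; linarith
      have h1 := key r hr _ (hg r hr) _ ht ht1
      have h2 : u r * u' r ≤ |u r * u' r| := le_abs_self _
      set t := (r - a) / (c - a)
      have h3 : t * (u r * u' r) ≤ t * |u r * u' r| := by gcongr
      have h0 : 0 ≤ 1 / (c - a) * u r ^ 2 := by positivity
      have h0' : 0 ≤ (c - a) * g r ^ 2 := by positivity
      have h5 : 8 / (c - a) * u r ^ 2 = 8 * (1 / (c - a) * u r ^ 2) := by ring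
      rw [h5]
      calc _ ≤ (r * (1 / (c - a)) + r * (1 / (c - a))) * u r ^ 2
            + r * t * (2 * u r * u' r) := by gcongr
        _ = r * (2 * (1 / (c - a) * u r ^ 2) + 2 * (t * (u r * u' r))) := by ring
        _ ≤ _ := by refine mul_le_mul_of_nonneg_left ?_ hr0.le; linarith

open Set MeasureTheory Metric in
/-- Integration in polar coordinates over an annulus. -/
lemma setIntegral_annulus_eq {ρ₁ ρ₂ : ℝ} (h1 : 0 ≤ ρ₁) (F : ℂ → ℝ) :
    ∫ x in ball (0 : ℂ) ρ₂ \ closedBall (0 : ℂ) ρ₁, F x =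
      ∫ p in Ioo ρ₁ ρ₂ ×ˢ Ioo (-Real.pi) Real.pi,
        p.1 * F (p.1 * Complex.exp (p.2 * Complex.I)) := by
  rw [← integral_indicator (measurableSet_ball.diff measurableSet_closedBall),
    ← Complex.integral_comp_polarCoord_symm, polarCoord_target,
    ← integral_indicator (measurableSet_Ioi.prod measurableSet_Ioo),
    ← integral_indicator (measurableSet_Ioo.prod measurableSet_Ioo)]
  congr 1 with ⟨r, θ⟩
  have hsymm : Complex.polarCoord.symm (r, θ) = r * Complex.exp (θ * Complex.I) := by
    simp [Complex.polarCoord_symm_apply, Complex.exp_mul_I]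
  by_cases hθ : θ ∈ Ioo (-Real.pi) Real.pi
  · by_cases hr : 0 < r
    · by_cases hA : r ∈ Ioo ρ₁ ρ₂
      · have hA' := hA
        simp only [mem_Ioo] at hA' hθ
        simp [indicator, hsymm, hA', hθ, hr, abs_of_pos hr]
      · have hA' := hA
        simp only [mem_Ioo] at hA' hθ
        have : ¬ (r < ρ₂ ∧ ρ₁ < r) := fun h ↦ hA' h.symm
        simp [indicator, hsymm, hA', this, hθ, hr, abs_of_pos hr]
    · have hA : r ∉ Ioo ρ₁ ρ₂ := fun h ↦ hr (h1.trans_lt h.1)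
      rw [indicator_of_notMem (by simp [hr]), indicator_of_notMem (fun h ↦ hA h.1)]
  · rw [indicator_of_notMem (fun h ↦ hθ h.2), indicator_of_notMem (fun h ↦ hθ h.2)]

open Set MeasureTheory Metric in
theorem stmt_6 (ρ₁ ρ₂ : ℝ) (h1 : 0 < ρ₁) (h12 : ρ₁ < ρ₂) (φ : ℂ → ℝ)
    (hφ : ContDiffOn ℝ 1 φ (Metric.closedBall (0:ℂ) ρ₂ \ Metric.ball (0:ℂ) ρ₁)) :
    ∀ ρ ∈ ({ρ₁, ρ₂} : Set ℝ),
      (∫ θ in (0:ℝ)..(2 * Real.pi), φ ((ρ : ℂ) * Complex.exp (θ * Complex.I)) ^ 2 * ρ) ≤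
        8 / (ρ₂ - ρ₁) *
            (∫ x in Metric.ball (0:ℂ) ρ₂ \ Metric.closedBall (0:ℂ) ρ₁, φ x ^ 2) +
          4 * (ρ₂ - ρ₁) *
            (∫ x in Metric.ball (0:ℂ) ρ₂ \ Metric.closedBall (0:ℂ) ρ₁, ‖fderiv ℝ φ x‖ ^ 2) := by
  set A := ball (0:ℂ) ρ₂ \ closedBall (0:ℂ) ρ₁ with hA
  set K := closedBall (0:ℂ) ρ₂ \ ball (0:ℂ) ρ₁ with hK
  have hAo : IsOpen A := isOpen_ball.sdiff isClosed_closedBall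
  have hKc : IsCompact K := (isCompact_closedBall _ _).diff isOpen_ball
  have hAK : A ⊆ K := sdiff_subset_sdiff ball_subset_closedBall ball_subset_closedBall
  have hAint : A ⊆ interior K := interior_maximal hAK hAo
  have hAfin : volume A < ⊤ := (measure_mono hAK).trans_lt hKc.measure_lt_top
  have hφA : ContDiffOn ℝ 1 φ A := hφ.mono hAK
  have hDcont : ContinuousOn (fderiv ℝ φ) A := hφA.continuousOn_fderiv_of_isOpen hAo le_rfl
  obtain ⟨M, hM⟩ := hKc.exists_bound_of_continuousOn hφ.continuousOn
  obtain ⟨C, hC⟩ := hKc.exists_norm_fderiv_le_of_contDiffOn hφ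
  have hb1 : ∀ x ∈ A, φ x ^ 2 ≤ M ^ 2 := fun x hx ↦
    sq_le_sq' (abs_le.1 (hM x (hAK hx))).1 (abs_le.1 (hM x (hAK hx))).2
  have hb2 : ∀ x ∈ A, ‖fderiv ℝ φ x‖ ^ 2 ≤ C ^ 2 := fun x hx ↦ by
    gcongr; exact hC x (hAint hx)
  have hi1 : IntegrableOn (fun x ↦ φ x ^ 2) A :=
    .of_bound hAfin ((hφA.continuousOn.pow 2).aestronglyMeasurable hAo.measurableSet) (M ^ 2)
      (ae_restrict_of_forall_mem hAo.measurableSet fun x hx ↦ by simpa using hb1 x hx)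
  have hi2 : IntegrableOn (fun x ↦ ‖fderiv ℝ φ x‖ ^ 2) A :=
    .of_bound hAfin ((hDcont.norm.pow 2).aestronglyMeasurable hAo.measurableSet) (C ^ 2)
      (ae_restrict_of_forall_mem hAo.measurableSet fun x hx ↦ by simpa using hb2 x hx)
  rw [← integral_const_mul, ← integral_const_mul,
    ← integral_add (hi1.const_mul _) (hi2.const_mul _), setIntegral_annulus_eq h1.le]
  have hba : 0 < ρ₂ - ρ₁ := sub_pos.2 h12
  set S := Ioo ρ₁ ρ₂ ×ˢ Ioo (-Real.pi) Real.pi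
  have hSm : MeasurableSet S := measurableSet_Ioo.prod measurableSet_Ioo
  have hSfin : volume S < ⊤ := by
    rw [Measure.volume_eq_prod, Measure.prod_prod]
    exact ENNReal.mul_lt_top (by simp) (by simp)
  have hnorm : ∀ {r : ℝ} (θ : ℝ), 0 < r → ‖(r : ℂ) * Complex.exp (θ * Complex.I)‖ = r := by
    intro r θ hr
    simp [Complex.norm_exp_ofReal_mul_I, abs_of_pos hr]
  have hmemA : ∀ r ∈ Ioo ρ₁ ρ₂, ∀ θ : ℝ, (r : ℂ) * Complex.exp (θ * Complex.I) ∈ A := by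
    intro r hr θ
    simp only [hA, mem_sdiff, mem_ball_zero_iff, mem_closedBall_zero_iff,
      hnorm θ (h1.trans hr.1), not_le]
    exact hr.symm
  have hmemK : ∀ r ∈ Icc ρ₁ ρ₂, ∀ θ : ℝ, (r : ℂ) * Complex.exp (θ * Complex.I) ∈ K := by
    intro r hr θ
    simp only [hK, mem_sdiff, mem_ball_zero_iff, mem_closedBall_zero_iff,
      hnorm θ (h1.trans_le hr.1), not_lt]
    exact hr.symm
  set G : ℝ × ℝ → ℝ := fun p ↦ p.1 * (8 / (ρ₂ - ρ₁) * φ (p.1 * Complex.exp (p.2 * Complex.I)) ^ 2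
    + 4 * (ρ₂ - ρ₁) * ‖fderiv ℝ φ (p.1 * Complex.exp (p.2 * Complex.I))‖ ^ 2) with hG
  have hpol : Continuous fun p : ℝ × ℝ ↦ (p.1 : ℂ) * Complex.exp (p.2 * Complex.I) := by fun_prop
  have hGcont : ContinuousOn G (Ioo ρ₁ ρ₂ ×ˢ univ) := by
    have hmaps : MapsTo (fun p : ℝ × ℝ ↦ (p.1 : ℂ) * Complex.exp (p.2 * Complex.I))
      (Ioo ρ₁ ρ₂ ×ˢ univ) A := fun p hp ↦ hmemA _ hp.1 _
    have c1 := hφA.continuousOn.comp hpol.continuousOn hmaps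
    have c2 := hDcont.comp hpol.continuousOn hmaps
    exact continuousOn_fst.mul ((continuousOn_const.mul (c1.pow 2)).add
      (continuousOn_const.mul (c2.norm.pow 2)))
  have hGbound : ∀ r ∈ Ioo ρ₁ ρ₂, ∀ θ,
      ‖G (r, θ)‖ ≤ ρ₂ * (8 / (ρ₂ - ρ₁) * M ^ 2 + 4 * (ρ₂ - ρ₁) * C ^ 2) := by
    intro r hr θ
    have hr0 : 0 < r := h1.trans hr.1
    rw [Real.norm_of_nonneg (by simp only [hG]; positivity)]
    have e1 := hb1 _ (hmemA r hr θ)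
    have e2 := hb2 _ (hmemA r hr θ)
    simp only [hG]
    gcongr
    exacts [(hr0.trans hr.2).le, hr.2.le]
  have hGint : IntegrableOn G S :=
    .of_bound hSfin ((hGcont.mono (prod_mono_right (subset_univ _))).aestronglyMeasurable hSm) _
      (ae_restrict_of_forall_mem hSm fun p hp ↦ hGbound p.1 hp.1 p.2)
  have hGr : ∀ θ, IntegrableOn (fun r ↦ G (r, θ)) (Ioo ρ₁ ρ₂) := fun θ ↦
    .of_bound (by simp) ((hGcont.comp (by fun_prop) fun r hr ↦
      ⟨hr, mem_univ _⟩).aestronglyMeasurable measurableSet_Ioo) _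
      (ae_restrict_of_forall_mem measurableSet_Ioo fun r hr ↦ hGbound r hr θ)
  have hGswap : IntegrableOn (G ∘ Prod.swap) (Ioo (-Real.pi) Real.pi ×ˢ Ioo ρ₁ ρ₂) :=
    IntegrableOn.swap hGint
  have hfub : ∫ p in S, G p = ∫ θ in Ioo (-Real.pi) Real.pi, ∫ r in Ioo ρ₁ ρ₂, G (r, θ) := by
    rw [Measure.volume_eq_prod, ← setIntegral_prod_swap]
    exact setIntegral_prod (G ∘ Prod.swap) hGswap
  intro ρ hρ
  have hρK : ρ ∈ Icc ρ₁ ρ₂ := by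
    rcases hρ with rfl | rfl
    · exact left_mem_Icc.2 h12.le
    · exact right_mem_Icc.2 h12.le
  rw [hfub]
  have hper : Function.Periodic
      (fun θ : ℝ ↦ φ ((ρ : ℂ) * Complex.exp (θ * Complex.I)) ^ 2 * ρ) (2 * Real.pi) := by
    intro θ
    have : Complex.exp (((θ + 2 * Real.pi : ℝ) : ℂ) * Complex.I)
        = Complex.exp (θ * Complex.I) := by
      push_cast
      rw [add_mul, Complex.exp_periodic]
    simp only [this]
  have hshift := hper.intervalIntegral_add_eq 0 (-Real.pi)
  rw [zero_add, show -Real.pi + 2 * Real.pi = Real.pi by ring] at hshift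
  rw [hshift, intervalIntegral.integral_of_le (by linarith [Real.pi_pos]),
    integral_Ioc_eq_integral_Ioo]
  refine setIntegral_mono_on ?_ ?_ measurableSet_Ioo fun θ _ ↦ ?_
  · have hc : Continuous fun θ : ℝ ↦ φ ((ρ : ℂ) * Complex.exp (θ * Complex.I)) ^ 2 * ρ :=
      ((hφ.continuousOn.comp_continuous (by fun_prop) (hmemK ρ hρK)).pow 2).mul continuous_const
    exact (hc.integrableOn_Icc (a := -Real.pi) (b := Real.pi)).mono_set Ioo_subset_Icc_self
  · rw [IntegrableOn, Measure.volume_eq_prod, ← Measure.prod_restrict] at hGswap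
    exact hGswap.integral_prod_left
  · refine trace_sq_le_setIntegral h1 h12
      (u := fun r : ℝ ↦ φ (r * Complex.exp (θ * Complex.I)))
      (g := fun r : ℝ ↦ ‖fderiv ℝ φ (r * Complex.exp (θ * Complex.I))‖) ?_ ?_ (hGr θ) ρ hρ
    · exact hφ.continuousOn.comp (by fun_prop) fun r hr ↦ hmemK r hr θ
    · intro r hr
      have hdiff := (hφA.differentiableOn (by simp)).differentiableAt
        (hAo.mem_nhds (hmemA r hr θ))
      have hline : HasDerivAt (fun r : ℝ ↦ (r : ℂ) * Complex.exp (θ * Complex.I))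
          (Complex.exp (θ * Complex.I)) r := by
        simpa using (Complex.ofRealCLM.hasDerivAt (x := r)).mul_const
          (Complex.exp (θ * Complex.I))
      refine ⟨_, hdiff.hasFDerivAt.comp_hasDerivAt r hline, ?_⟩
      simpa [Complex.norm_exp_ofReal_mul_I] using
        (fderiv ℝ φ (r * Complex.exp (θ * Complex.I))).le_opNorm (Complex.exp (θ * Complex.I))
end

section
/- Fix α ∈ (0,1). For all positive d and r_max with d < r_max, and all constants C₁, C₂, C₃ > 0, there exists a constant C = C(d, r_max, α, C₁, C₂, C₃) with the following property. Let R satisfy d ≤ R ≤ r_max and Ω = {x ∈ ℝ² : R < |x| < R + d}. Let v be harmonic in Ω, and let ζ ∈ C_c^∞(ℝ²) satisfy 0 ≤ ζ ≤ 1, supp ζ ⊂ B_{R+2d/3}(0), ζ ≡ 1 on B̄_{R+d/3}(0), and |Dᵏζ(x)| ≤ C_k d^{−k} for k = 1,2,3 and all x. Define F : ℝ² → ℝ by F = 2Dv·Dζ + vΔζ on Ω and F = 0 outside Ω (so F = Δ(vζ) in Ω and vanishes where vζ is not defined or ζ is constant). Then ‖F‖_{∞(ℝ²)} + [F]_{0,α(ℝ²)}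 ≤ C ‖v‖_{L¹(Ω)}. -/
/-- The Laplacian of `v : ℂ → ℝ` at `x`, computed from iterated (Fréchet) derivatives
in the directions `1` and `I` of `ℂ ≃ ℝ²`. -/
noncomputable def lapl (v : ℂ → ℝ) (x : ℂ) : ℝ :=
  fderiv ℝ (fun y => fderiv ℝ v y 1) x 1 +
    fderiv ℝ (fun y => fderiv ℝ v y Complex.I) x Complex.I

/-- `v` is twice continuously differentiable and harmonic on `s`. -/
def HarmonicOnn (v : ℂ → ℝ) (s : Set ℂ) : Prop :=
  ContDiffOn ℝ 2 v s ∧ ∀ x ∈ s, lapl v x = 0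

open Set Metric MeasureTheory InnerProductSpace Complex

theorem enorm_le_lintegral_of_harmonicOnNhd {v : ℂ → ℝ} {x : ℂ} {r s : ℝ}
    (hv : HarmonicOnNhd v (ball x r)) (hs : 0 < s) (hsr : s < r) :
    ‖v x‖ₑ * ENNReal.ofReal (2 * Real.pi) ≤
      ∫⁻ θ in Ioo (-Real.pi) Real.pi, ‖v (circleMap x s θ)‖ₑ := by
  have hball : closedBall x |s| ⊆ ball x r := by
    rw [abs_of_pos hs]; exact closedBall_subset_ball hsr
  have hmean := (hv.mono hball).circleAverage_eq
  rw [Real.circleAverage_eq_integral_add (-Real.pi),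
    intervalIntegral.integral_comp_add_right (fun θ => v (circleMap x s θ)),
    intervalIntegral.integral_of_le (by linarith [Real.pi_pos])] at hmean
  have e1 : (0 : ℝ) + -Real.pi = -Real.pi := by ring
  have e2 : 2 * Real.pi + -Real.pi = Real.pi := by ring
  rw [e1, e2] at hmean
  have h2pi : (0 : ℝ) < 2 * Real.pi := by positivity
  have hint : ∫ θ in Ioc (-Real.pi) Real.pi, v (circleMap x s θ) = 2 * Real.pi * v x := by
    rw [← hmean, smul_eq_mul, mul_inv_cancel_left₀ h2pi.ne']
  rw [restrict_Ioo_eq_restrict_Ioc]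
  calc ‖v x‖ₑ * ENNReal.ofReal (2 * Real.pi)
      = ‖∫ θ in Ioc (-Real.pi) Real.pi, v (circleMap x s θ)‖ₑ := by
        rw [hint, enorm_mul, Real.enorm_of_nonneg h2pi.le, mul_comm]
    _ ≤ _ := enorm_integral_le_lintegral_enorm _

theorem enorm_mul_le_lintegral_ball {v : ℂ → ℝ} {x : ℂ} {r : ℝ} (hr : 0 < r)
    (hv : HarmonicOnNhd v (ball x r)) :
    ‖v x‖ₑ * ENNReal.ofReal (2 * Real.pi * (r / 2) ^ 2) ≤ ∫⁻ y in ball x r, ‖v y‖ₑ := by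
  have hmeas : Measurable ((ball x r).indicator v) := by
    classical
    rw [← piecewise_eq_indicator]
    exact hv.continuousOn.measurable_piecewise continuousOn_const measurableSet_ball
  set g : ℂ → ENNReal := fun y => ‖(ball x r).indicator v y‖ₑ with hg
  have hgm : Measurable g := hmeas.enorm
  have hpolar : Measurable fun p : ℝ × ℝ =>
      ENNReal.ofReal p.1 * g (x + Complex.polarCoord.symm p) := by
    refine (ENNReal.measurable_ofReal.comp measurable_fst).mul (hgm.comp ?_)
    simp only [Complex.polarCoord_symm_apply]
    fun_prop
  calc ‖v x‖ₑ * ENNReal.ofReal (2 * Real.pi * (r / 2) ^ 2)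
      = ∫⁻ _ in Ioo (r / 2) r,
          ENNReal.ofReal (r / 2) * (‖v x‖ₑ * ENNReal.ofReal (2 * Real.pi)) := by
        rw [setLIntegral_const, Real.volume_Ioo, mul_comm (ENNReal.ofReal (r / 2)),
          mul_assoc (‖v x‖ₑ * _), mul_assoc ‖v x‖ₑ, ← ENNReal.ofReal_mul (by positivity),
          ← ENNReal.ofReal_mul (by positivity)]
        congr 2; ring
    _ ≤ ∫⁻ s in Ioo (r / 2) r, ∫⁻ θ in Ioo (-Real.pi) Real.pi,
          ENNReal.ofReal s * g (x + Complex.polarCoord.symm (s, θ)) := by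
        refine setLIntegral_mono' measurableSet_Ioo fun s hs => ?_
        have hs0 : 0 < s := lt_trans (by positivity) hs.1
        rw [lintegral_const_mul' _ _ ENNReal.ofReal_ne_top]
        refine mul_le_mul' (ENNReal.ofReal_le_ofReal hs.1.le) ?_
        refine (enorm_le_lintegral_of_harmonicOnNhd hv hs0 hs.2).trans (le_of_eq ?_)
        refine lintegral_congr fun θ => ?_
        have hc : x + Complex.polarCoord.symm (s, θ) = circleMap x s θ := by
          rw [Complex.polarCoord_symm_apply, circleMap, Complex.exp_mul_I]
          push_cast; rfl
        have hm : circleMap x s θ ∈ ball x r := by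
          rw [mem_ball, dist_eq_norm, circleMap_sub_center, norm_circleMap_zero, abs_of_pos hs0]
          exact hs.2
        rw [hc, hg]
        simp only [indicator_of_mem hm]
    _ ≤ ∫⁻ s in Ioi 0, ∫⁻ θ in Ioo (-Real.pi) Real.pi,
          ENNReal.ofReal s * g (x + Complex.polarCoord.symm (s, θ)) :=
        lintegral_mono_set fun s hs => lt_trans (by positivity) hs.1
    _ = ∫⁻ p in polarCoord.target,
          ENNReal.ofReal p.1 • g (x + Complex.polarCoord.symm p) := by
        rw [polarCoord_target, Measure.volume_eq_prod, setLIntegral_prod]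
        · rfl
        · exact hpolar.aemeasurable
    _ = ∫⁻ y, g (x + y) := Complex.lintegral_comp_polarCoord_symm fun y => g (x + y)
    _ = ∫⁻ y, g y := lintegral_add_left_eq_self g x
    _ = ∫⁻ y in ball x r, ‖v y‖ₑ := by
        simp only [hg, enorm_indicator_eq_indicator_enorm]
        rw [lintegral_indicator measurableSet_ball]

theorem abs_le_integral_of_harmonicOnNhd {v : ℂ → ℝ} {Ω : Set ℂ} {x : ℂ} {r : ℝ} (hr : 0 < r)
    (hv : HarmonicOnNhd v Ω) (hint : IntegrableOn (fun y => |v y|) Ω) (hsub : ball x r ⊆ Ω) :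
    |v x| ≤ (2 * Real.pi * (r / 2) ^ 2)⁻¹ * ∫ y in Ω, |v y| := by
  have hc : 0 < 2 * Real.pi * (r / 2) ^ 2 := by positivity
  have h : ‖v x‖ₑ * ENNReal.ofReal (2 * Real.pi * (r / 2) ^ 2) ≤
      ENNReal.ofReal (∫ y in Ω, |v y|) := by
    rw [ofReal_integral_eq_lintegral_ofReal hint (Filter.Eventually.of_forall fun y => abs_nonneg _)]
    refine (enorm_mul_le_lintegral_ball hr (hv.mono hsub)).trans
      ((lintegral_mono_set hsub).trans (le_of_eq ?_))
    exact lintegral_congr fun y => (ofReal_norm (v y)).symm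
  rw [← ofReal_norm, ← ENNReal.ofReal_mul (norm_nonneg _),
    ENNReal.ofReal_le_ofReal_iff (integral_nonneg fun _ => abs_nonneg _), Real.norm_eq_abs] at h
  rwa [inv_mul_eq_div, le_div_iff₀ hc]

/-- The complex gradient `∂v/∂1 - i ∂v/∂I`. -/
noncomputable def complexGradient (v : ℂ → ℝ) (z : ℂ) : ℂ :=
  (fderiv ℝ v z 1 : ℂ) - I * fderiv ℝ v z I

theorem re_complexGradient (v : ℂ → ℝ) (z : ℂ) : (complexGradient v z).re = fderiv ℝ v z 1 := by
  simp [complexGradient]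

theorem im_complexGradient (v : ℂ → ℝ) (z : ℂ) : (complexGradient v z).im = -fderiv ℝ v z I := by
  simp [complexGradient]

theorem complexGradient_eq_deriv {v : ℂ → ℝ} {f : ℂ → ℂ} {x : ℂ}
    (hf : DifferentiableAt ℂ f x) (hfv : (fun z => (f z).re) =ᶠ[nhds x] v) :
    complexGradient v x = deriv f x := by
  have h := (Complex.reCLM.hasFDerivAt.comp x (hf.hasDerivAt.hasFDerivAt.restrictScalars ℝ))
  have h2 : fderiv ℝ v x = _ := (h.congr_of_eventuallyEq hfv.symm).fderiv
  apply Complex.ext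
  · rw [re_complexGradient, h2]; simp
  · rw [im_complexGradient, h2]; simp

theorem norm_complexGradient_le_of_abs_le {v : ℂ → ℝ} {x : ℂ} {r M : ℝ} (hr : 0 < r)
    (hv : HarmonicOnNhd v (ball x r)) (hM : ∀ y ∈ ball x r, |v y| ≤ M) :
    ‖complexGradient v x‖ ≤ Real.exp 2 * M / (r / 2) := by
  have key : ∀ N > M, ‖complexGradient v x‖ ≤ Real.exp 2 * N / (r / 2) := by
    intro N hN
    have hx : x ∈ ball x r := mem_ball_self hr
    have hN0 : 0 < N := (abs_nonneg _).trans_lt ((hM x hx).trans_lt hN)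
    obtain ⟨f, hf, hfv⟩ := hv.exists_analyticOnNhd_ball_re_eq
    have hfx := (hf x hx).differentiableAt
    rw [complexGradient_eq_deriv hfx (Filter.eventually_of_mem (ball_mem_nhds x hr) hfv)]
    have hsub : closedBall x (r / 2) ⊆ ball x r := closedBall_subset_ball (by linarith)
    have hre : ∀ z ∈ ball x r, ‖(f z / N).re‖ ≤ 1 := by
      intro z hz
      have h1 : (f z).re = v z := hfv hz
      rw [Complex.div_ofReal_re, h1, Real.norm_eq_abs, abs_div, abs_of_pos hN0, div_le_one hN0]
      exact (hM z hz).trans hN.le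
    have hdiff : DifferentiableOn ℂ (fun z => exp (f z / N)) (ball x r) := fun z hz =>
      ((hf z hz).differentiableAt.div_const _).cexp.differentiableWithinAt
    have hC := norm_deriv_le_of_forall_mem_sphere_norm_le (half_pos hr)
      (f := fun z => exp (f z / N)) (C := Real.exp 1)
      ((hdiff.mono hsub).diffContOnCl_ball subset_rfl) fun z hz => by
        rw [Complex.norm_exp, Real.exp_le_exp]
        exact (le_abs_self _).trans (hre z (hsub (sphere_subset_closedBall hz)))
    have hd : deriv (fun z => exp (f z / N)) x = exp (f x / N) * (deriv f x / N) :=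
      (hfx.hasDerivAt.div_const (N : ℂ)).cexp.deriv
    rw [hd, norm_mul, Complex.norm_exp, norm_div, Complex.norm_real, Real.norm_of_nonneg hN0.le]
      at hC
    have hlow : Real.exp (-1) ≤ Real.exp (f x / N).re :=
      Real.exp_le_exp.2 (abs_le.1 (hre x hx)).1
    have h2 := (mul_le_mul_of_nonneg_right hlow (by positivity : 0 ≤ ‖deriv f x‖ / N)).trans hC
    rw [Real.exp_neg, inv_mul_le_iff₀ (Real.exp_pos 1), div_le_iff₀ hN0] at h2
    refine h2.trans (le_of_eq ?_)
    rw [show (2 : ℝ) = 1 + 1 by norm_num, Real.exp_add]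
    ring
  refine ge_of_tendsto (f := fun N => Real.exp 2 * N / (r / 2)) (x := nhdsWithin M (Ioi M)) ?_
    (eventually_nhdsWithin_of_forall key)
  exact ((Continuous.tendsto (by fun_prop) M).mono_left nhdsWithin_le_nhds)

theorem exists_interior_estimate {r : ℝ} (hr : 0 < r) :
    ∃ K : ℝ, 0 < K ∧ ∀ (v : ℂ → ℝ) (Ω : Set ℂ) (x : ℂ), HarmonicOnNhd v Ω →
      IntegrableOn (fun y => |v y|) Ω → ball x r ⊆ Ω →
      |v x| ≤ K * (∫ y in Ω, |v y|) ∧ ‖complexGradient v x‖ ≤ K * (∫ y in Ω, |v y|) ∧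
        ‖deriv (complexGradient v) x‖ ≤ K * ∫ y in Ω, |v y| := by
  set k : ℝ := (2 * Real.pi * (r / 4 / 2) ^ 2)⁻¹ with hk
  have hk0 : 0 < k := by positivity
  set k₁ : ℝ := Real.exp 2 * k / (r / 4 / 2)
  have hk₁ : 0 < k₁ := by positivity
  set k₂ : ℝ := k₁ / (r / 2)
  have hk₂ : 0 < k₂ := by positivity
  refine ⟨k + k₁ + k₂, by positivity, fun v Ω x hv hint hsub => ?_⟩
  have hI : 0 ≤ ∫ y in Ω, |v y| := integral_nonneg fun _ => abs_nonneg _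
  set I := ∫ y in Ω, |v y|
  have hball : ∀ {y : ℂ} {s t : ℝ}, y ∈ closedBall x t → s + t ≤ r → ball y s ⊆ Ω :=
    fun hy hst => (ball_subset_ball' (by rw [mem_closedBall] at hy; linarith)).trans hsub
  have h0 : ∀ y ∈ closedBall x (3 * r / 4), |v y| ≤ k * I := fun y hy =>
    abs_le_integral_of_harmonicOnNhd (by positivity) hv hint (hball hy (by linarith))
  have h1 : ∀ y ∈ closedBall x (r / 2), ‖complexGradient v y‖ ≤ k₁ * I := fun y hy => by
    have := norm_complexGradient_le_of_abs_le (x := y) (r := r / 4) (M := k * I) (by positivity)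
      (hv.mono (hball hy (by linarith))) fun z hz => h0 z <| by
        rw [mem_closedBall] at hy ⊢
        rw [mem_ball] at hz
        linarith [dist_triangle z y x]
    exact this.trans (le_of_eq (by simp only [k₁]; ring))
  have hdiff : DifferentiableOn ℂ (complexGradient v) (closedBall x (r / 2)) := fun y hy =>
    (HarmonicAt.differentiableAt_complex_partial
      (hv y (hsub (closedBall_subset_ball (by linarith) hy)))).differentiableWithinAt
  have h2 : ‖deriv (complexGradient v) x‖ ≤ k₁ * I / (r / 2) :=
    norm_deriv_le_of_forall_mem_sphere_norm_le (half_pos hr)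
      (hdiff.diffContOnCl_ball subset_rfl) fun z hz => h1 z (sphere_subset_closedBall hz)
  have h2' : k₁ * I / (r / 2) = k₂ * I := by simp only [k₂]; ring
  have a0 := mul_nonneg hk0.le hI
  have a1 := mul_nonneg hk₁.le hI
  have a2 := mul_nonneg hk₂.le hI
  have b0 := h0 x (mem_closedBall_self (by positivity))
  have b1 := h1 x (mem_closedBall_self (by positivity))
  rw [h2'] at h2
  simp only [add_mul]
  exact ⟨by linarith, by linarith, by linarith⟩

theorem HarmonicOnn.harmonicOnNhd {v : ℂ → ℝ} {s : Set ℂ} (hs : IsOpen s)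
    (hv : HarmonicOnn v s) : HarmonicOnNhd v s := by
  intro x hx
  refine ⟨hv.1.contDiffAt (hs.mem_nhds hx), ?_⟩
  filter_upwards [hs.mem_nhds hx] with y hy
  have hc : ContDiffAt ℝ 2 v y := hv.1.contDiffAt (hs.mem_nhds hy)
  have hd : DifferentiableAt ℝ (fderiv ℝ v) y :=
    (hc.fderiv_right (m := 1) (by norm_num)).differentiableAt (by norm_num)
  have := hv.2 y hy
  rw [lapl, fderiv_clm_apply hd (by fun_prop), fderiv_clm_apply hd (by fun_prop)] at this
  rw [laplacian_eq_iteratedFDeriv_complexPlane]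
  simpa [iteratedFDeriv_two_apply] using this

theorem fderiv_bounds_of_harmonicAt {v : ℂ → ℝ} {x : ℂ} {M : ℝ} (hv : HarmonicAt v x)
    (h1 : ‖complexGradient v x‖ ≤ M) (h2 : ‖deriv (complexGradient v) x‖ ≤ M) (w : ℂ)
    (hw : w = 1 ∨ w = I) :
    |fderiv ℝ v x w| ≤ M ∧ DifferentiableAt ℝ (fun y => fderiv ℝ v y w) x ∧
      ‖fderiv ℝ (fun y => fderiv ℝ v y w) x‖ ≤ M := by
  have hg : DifferentiableAt ℂ (complexGradient v) x :=
    HarmonicAt.differentiableAt_complex_partial hv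
  have hgf := hg.hasDerivAt.hasFDerivAt.restrictScalars ℝ
  have hM : 0 ≤ M := (norm_nonneg _).trans h1
  rcases hw with rfl | rfl
  · have hp : HasFDerivAt (fun y => fderiv ℝ v y 1) _ x :=
      (Complex.reCLM.hasFDerivAt.comp x hgf).congr_of_eventuallyEq
        (Filter.Eventually.of_forall fun y => (re_complexGradient v y).symm)
    refine ⟨?_, hp.differentiableAt, ?_⟩
    · rw [← re_complexGradient]; exact (Complex.abs_re_le_norm _).trans h1
    · rw [hp.fderiv]
      refine ContinuousLinearMap.opNorm_le_bound _ hM fun h => ?_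
      refine (Complex.abs_re_le_norm _).trans ?_
      have := mul_le_mul_of_nonneg_left h2 (norm_nonneg h)
      simpa [mul_comm M] using this
  · have hp : HasFDerivAt (fun y => fderiv ℝ v y I) _ x :=
      (Complex.imCLM.hasFDerivAt.comp x hgf).neg.congr_of_eventuallyEq
        (Filter.Eventually.of_forall fun y => by simp [im_complexGradient])
    refine ⟨?_, hp.differentiableAt, ?_⟩
    · rw [← abs_neg, ← im_complexGradient]; exact (Complex.abs_im_le_norm _).trans h1
    · rw [hp.fderiv, norm_neg]
      refine ContinuousLinearMap.opNorm_le_bound _ hM fun h => ?_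
      refine (Complex.abs_im_le_norm _).trans ?_
      have := mul_le_mul_of_nonneg_left h2 (norm_nonneg h)
      simpa [mul_comm M] using this

theorem norm_fderiv_le_norm_complexGradient (v : ℂ → ℝ) (x : ℂ) :
    ‖fderiv ℝ v x‖ ≤ 2 * ‖complexGradient v x‖ := by
  refine ContinuousLinearMap.opNorm_le_bound _ (by positivity) fun h => ?_
  have hh : fderiv ℝ v x h = h.re * (complexGradient v x).re - h.im * (complexGradient v x).im := by
    nth_rw 1 [show h = h.re • (1 : ℂ) + h.im • I by simp]
    rw [map_add, map_smul, map_smul, re_complexGradient, im_complexGradient]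
    simp
  rw [hh, Real.norm_eq_abs]
  refine (abs_sub _ _).trans ?_
  rw [abs_mul, abs_mul]
  have := mul_le_mul (abs_re_le_norm h) (abs_re_le_norm (complexGradient v x)) (abs_nonneg _)
    (norm_nonneg _)
  have := mul_le_mul (abs_im_le_norm h) (abs_im_le_norm (complexGradient v x)) (abs_nonneg _)
    (norm_nonneg _)
  linarith

theorem fderiv_fderiv_apply_bounds {f : ℂ → ℝ} {x w : ℂ} {A : ℝ}
    (hf : ContDiff ℝ 2 f) (h1 : ‖iteratedFDeriv ℝ 1 f x‖ ≤ A)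
    (h2 : ‖iteratedFDeriv ℝ 2 f x‖ ≤ A) (hw : ‖w‖ = 1) :
    |fderiv ℝ f x w| ≤ A ∧ DifferentiableAt ℝ (fun y => fderiv ℝ f y w) x ∧
      ‖fderiv ℝ (fun y => fderiv ℝ f y w) x‖ ≤ A := by
  have hd : DifferentiableAt ℝ (fderiv ℝ f) x :=
    (hf.fderiv_right (m := 1) (by norm_num)).differentiable (by norm_num) x
  rw [norm_iteratedFDeriv_one] at h1
  rw [← norm_iteratedFDeriv_fderiv, norm_iteratedFDeriv_one] at h2
  refine ⟨?_, hd.clm_apply (by fun_prop), ?_⟩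
  · simpa [hw] using (fderiv ℝ f x).le_of_opNorm_le h1 w
  · rw [fderiv_clm_apply hd (by fun_prop)]
    refine ContinuousLinearMap.opNorm_le_bound _ ((norm_nonneg _).trans h2) fun h => ?_
    have := (fderiv ℝ (fderiv ℝ f) x h).le_of_opNorm_le
      ((fderiv ℝ (fderiv ℝ f) x).le_of_opNorm_le h2 h) w
    simpa [hw] using this

set_option maxSynthPendingDepth 3 in
theorem norm_flip_flip_apply_le {E F : Type*} [NormedAddCommGroup E] [NormedSpace ℝ E]
    [NormedAddCommGroup F] [NormedSpace ℝ F] {T : E →L[ℝ] E →L[ℝ] E →L[ℝ] F} {w : E} {A : ℝ}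
    (hw : ‖w‖ = 1) (hT : ‖T‖ ≤ A) : ‖(T.flip w).flip w‖ ≤ A := by
  refine ContinuousLinearMap.opNorm_le_bound _ ((norm_nonneg _).trans hT) fun h => ?_
  have := (T h w).le_of_opNorm_le ((T h).le_of_opNorm_le (T.le_of_opNorm_le hT h) w) w
  rwa [hw, mul_one, mul_one] at this

set_option maxSynthPendingDepth 3 in
theorem lapl_bounds {f : ℂ → ℝ} {x : ℂ} {A : ℝ} (hf : ContDiff ℝ 3 f)
    (h2 : ‖iteratedFDeriv ℝ 2 f x‖ ≤ A) (h3 : ‖iteratedFDeriv ℝ 3 f x‖ ≤ A) :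
    |lapl f x| ≤ 2 * A ∧ DifferentiableAt ℝ (lapl f) x ∧ ‖fderiv ℝ (lapl f) x‖ ≤ 2 * A := by
  have hc : ContDiff ℝ 2 (fderiv ℝ f) := hf.fderiv_right (by norm_num)
  have hd : Differentiable ℝ (fderiv ℝ f) := hc.differentiable (by norm_num)
  have hd2 : Differentiable ℝ (fderiv ℝ (fderiv ℝ f)) :=
    (hc.fderiv_right (m := 1) (by norm_num)).differentiable (by norm_num)
  rw [← norm_iteratedFDeriv_fderiv, norm_iteratedFDeriv_one] at h2
  rw [← norm_iteratedFDeriv_fderiv, ← norm_iteratedFDeriv_fderiv, norm_iteratedFDeriv_one] at h3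
  have hA : 0 ≤ A := (norm_nonneg _).trans h2
  have hl : lapl f = fun y => fderiv ℝ (fderiv ℝ f) y 1 1 + fderiv ℝ (fderiv ℝ f) y I I := by
    funext y
    rw [lapl, fderiv_clm_apply (hd y) (by fun_prop), fderiv_clm_apply (hd y) (by fun_prop)]
    simp
  have hD : ∀ w : ℂ, HasFDerivAt (fun y => fderiv ℝ (fderiv ℝ f) y w w)
      (((fderiv ℝ (fderiv ℝ (fderiv ℝ f)) x).flip w).flip w) x := fun w => by
    have := ((hd2 x).hasFDerivAt.clm_apply (hasFDerivAt_const w x)).clm_apply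
      (hasFDerivAt_const w x)
    refine this.congr_fderiv ?_
    ext h
    simp
  have hL := (hD 1).add (hD I)
  rw [hl]
  refine ⟨?_, hL.differentiableAt, ?_⟩
  · refine (abs_add_le _ _).trans ?_
    have e : ∀ w : ℂ, ‖w‖ = 1 → |fderiv ℝ (fderiv ℝ f) x w w| ≤ A := fun w hw => by
      simpa [hw] using (fderiv ℝ (fderiv ℝ f) x w).le_of_opNorm_le
        ((fderiv ℝ (fderiv ℝ f) x).le_of_opNorm_le h2 w) w
    linarith [e 1 (by simp), e I (by simp)]
  · refine (le_of_eq (congrArg norm hL.fderiv)).trans ((norm_add_le _ _).trans ?_)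
    linarith [norm_flip_flip_apply_le (by simp : ‖(1 : ℂ)‖ = 1) h3,
      norm_flip_flip_apply_le (by simp : ‖I‖ = 1) h3]

theorem abs_mul_le_and_norm_fderiv_mul_le {f g : ℂ → ℝ} {x : ℂ} {M A : ℝ}
    (hf : |f x| ≤ M ∧ DifferentiableAt ℝ f x ∧ ‖fderiv ℝ f x‖ ≤ M)
    (hg : |g x| ≤ A ∧ DifferentiableAt ℝ g x ∧ ‖fderiv ℝ g x‖ ≤ A) :
    |f x * g x| ≤ M * A ∧ DifferentiableAt ℝ (fun y => f y * g y) x ∧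
      ‖fderiv ℝ (fun y => f y * g y) x‖ ≤ 2 * (M * A) := by
  obtain ⟨f0, fd, f1⟩ := hf
  obtain ⟨g0, gd, g1⟩ := hg
  have hM : 0 ≤ M := (abs_nonneg _).trans f0
  refine ⟨?_, fd.mul gd, ?_⟩
  · rw [abs_mul]; gcongr
  · rw [fderiv_fun_mul fd gd]
    refine (norm_add_le _ _).trans ?_
    rw [norm_smul, norm_smul, Real.norm_eq_abs, Real.norm_eq_abs]
    have := mul_le_mul f0 g1 (norm_nonneg _) hM
    have := mul_le_mul f1 g0 (abs_nonneg _) hM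
    linarith

theorem abs_le_and_norm_fderiv_le_of_eventuallyEq {v ζ F : ℂ → ℝ} {x : ℂ} {M A : ℝ}
    (hv : HarmonicAt v x) (v0 : |v x| ≤ M) (v1 : ‖complexGradient v x‖ ≤ M)
    (v2 : ‖deriv (complexGradient v) x‖ ≤ M) (hζ : ContDiff ℝ 3 ζ)
    (h1 : ‖iteratedFDeriv ℝ 1 ζ x‖ ≤ A) (h2 : ‖iteratedFDeriv ℝ 2 ζ x‖ ≤ A)
    (h3 : ‖iteratedFDeriv ℝ 3 ζ x‖ ≤ A)
    (hF : F =ᶠ[nhds x] fun x => 2 * (fderiv ℝ v x 1 * fderiv ℝ ζ x 1 +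
      fderiv ℝ v x I * fderiv ℝ ζ x I) + v x * lapl ζ x) :
    |F x| ≤ 16 * (M * A) ∧ DifferentiableAt ℝ F x ∧ ‖fderiv ℝ F x‖ ≤ 16 * (M * A) := by
  have hζ2 : ContDiff ℝ 2 ζ := hζ.of_le (by norm_num)
  have hM : 0 ≤ M := (abs_nonneg _).trans v0
  have hA : 0 ≤ A := (norm_nonneg _).trans h1
  obtain ⟨p0, pd, p1⟩ := abs_mul_le_and_norm_fderiv_mul_le
    (f := fun y => fderiv ℝ v y 1) (g := fun y => fderiv ℝ ζ y 1)
    (fderiv_bounds_of_harmonicAt hv v1 v2 1 (.inl rfl))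
    (fderiv_fderiv_apply_bounds hζ2 h1 h2 (w := 1) (by simp))
  obtain ⟨q0, qd, q1⟩ := abs_mul_le_and_norm_fderiv_mul_le
    (f := fun y => fderiv ℝ v y I) (g := fun y => fderiv ℝ ζ y I)
    (fderiv_bounds_of_harmonicAt hv v1 v2 I (.inr rfl))
    (fderiv_fderiv_apply_bounds hζ2 h1 h2 (w := I) (by simp))
  have hvb : |v x| ≤ 2 * M ∧ DifferentiableAt ℝ v x ∧ ‖fderiv ℝ v x‖ ≤ 2 * M :=
    ⟨by linarith, hv.1.differentiableAt two_ne_zero,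
      (norm_fderiv_le_norm_complexGradient v x).trans (by linarith)⟩
  obtain ⟨l0, ld, l1⟩ := abs_mul_le_and_norm_fderiv_mul_le hvb (lapl_bounds hζ h2 h3)
  have hMA := mul_nonneg hM hA
  refine ⟨?_, ((pd.add qd).const_mul 2 |>.add ld).congr_of_eventuallyEq hF, ?_⟩
  · rw [hF.eq_of_nhds]
    rw [abs_le] at p0 q0 l0 ⊢
    constructor <;> linarith
  · rw [hF.fderiv_eq, fderiv_fun_add ((pd.fun_add qd).const_mul 2) ld,
      fderiv_const_mul (pd.fun_add qd), fderiv_fun_add pd qd]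
    refine (norm_add_le _ _).trans ?_
    rw [norm_smul, Real.norm_of_nonneg (by norm_num : (0 : ℝ) ≤ 2)]
    have := norm_add_le (fderiv ℝ (fun y => fderiv ℝ v y 1 * fderiv ℝ ζ y 1) x)
      (fderiv ℝ (fun y => fderiv ℝ v y I * fderiv ℝ ζ y I) x)
    linarith

theorem hoelder_of_abs_le_of_norm_fderiv_le {F : ℂ → ℝ} {α B : ℝ} (hα0 : 0 ≤ α) (hα1 : α ≤ 1)
    (hF : ∀ x, |F x| ≤ B ∧ DifferentiableAt ℝ F x ∧ ‖fderiv ℝ F x‖ ≤ B) {x y : ℂ} (hxy : x ≠ y) :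
    |F x - F y| ≤ 2 * B * ‖x - y‖ ^ α := by
  have hB : 0 ≤ B := (abs_nonneg _).trans (hF x).1
  have hpos : 0 < ‖x - y‖ := norm_pos_iff.2 (sub_ne_zero.2 hxy)
  rcases le_total ‖x - y‖ 1 with h | h
  · have hlip := convex_univ.norm_image_sub_le_of_norm_fderiv_le (𝕜 := ℝ)
      (fun z _ => (hF z).2.1) (fun z _ => (hF z).2.2) (mem_univ y) (mem_univ x)
    have hp : ‖x - y‖ ≤ ‖x - y‖ ^ α := by
      simpa using Real.rpow_le_rpow_of_exponent_ge hpos h hα1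
    have := mul_le_mul_of_nonneg_left hp hB
    have := mul_nonneg hB (Real.rpow_nonneg hpos.le α)
    rw [Real.norm_eq_abs] at hlip
    linarith
  · have := mul_le_mul_of_nonneg_left (Real.one_le_rpow h hα0) hB
    have := abs_sub (F x) (F y)
    linarith [(hF x).1, (hF y).1]

theorem leibniz_term_eq_zero {v ζ : ℂ → ℝ} {x : ℂ} {c : ℝ} (h : ζ =ᶠ[nhds x] fun _ => c) :
    2 * (fderiv ℝ v x 1 * fderiv ℝ ζ x 1 + fderiv ℝ v x I * fderiv ℝ ζ x I) +
      v x * lapl ζ x = 0 := by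
  have hz : ∀ w : ℂ, (fun y => fderiv ℝ ζ y w) =ᶠ[nhds x] fun _ => 0 := fun w => by
    filter_upwards [h.eventuallyEq_nhds] with y hy
    rw [hy.fderiv_eq]; simp
  have h1 : ∀ w : ℂ, fderiv ℝ ζ x w = 0 := fun w => (hz w).eq_of_nhds
  rw [lapl, (hz 1).fderiv_eq, (hz I).fderiv_eq, h1, h1]
  simp

theorem stmt_8 (α d rmax C₁ C₂ C₃ : ℝ) (hα0 : 0 < α) (hα1 : α < 1) (hd : 0 < d)
    (hdr : d < rmax) (hC₁ : 0 < C₁) (hC₂ : 0 < C₂) (hC₃ : 0 < C₃) :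
    ∃ C : ℝ, 0 < C ∧
      ∀ R : ℝ, d ≤ R → R ≤ rmax →
        ∀ v : ℂ → ℝ,
          HarmonicOnn v (Metric.ball (0:ℂ) (R + d) \ Metric.closedBall (0:ℂ) R) →
          MeasureTheory.IntegrableOn (fun x => |v x|)
            (Metric.ball (0:ℂ) (R + d) \ Metric.closedBall (0:ℂ) R) →
          ∀ ζ : ℂ → ℝ,
            ContDiff ℝ (⊤ : ℕ∞) ζ →
            (∀ x, 0 ≤ ζ x) → (∀ x, ζ x ≤ 1) →
            tsupport ζ ⊆ Metric.ball (0:ℂ) (R + 2 * d / 3) →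
            (∀ x ∈ Metric.closedBall (0:ℂ) (R + d / 3), ζ x = 1) →
            (∀ x, ‖iteratedFDeriv ℝ 1 ζ x‖ ≤ C₁ / d) →
            (∀ x, ‖iteratedFDeriv ℝ 2 ζ x‖ ≤ C₂ / d ^ 2) →
            (∀ x, ‖iteratedFDeriv ℝ 3 ζ x‖ ≤ C₃ / d ^ 3) →
            ∀ F : ℂ → ℝ,
              (∀ x ∈ Metric.ball (0:ℂ) (R + d) \ Metric.closedBall (0:ℂ) R,
                F x = 2 * (fderiv ℝ v x 1 * fderiv ℝ ζ x 1 +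
                    fderiv ℝ v x Complex.I * fderiv ℝ ζ x Complex.I) + v x * lapl ζ x) →
              (∀ x, x ∉ Metric.ball (0:ℂ) (R + d) \ Metric.closedBall (0:ℂ) R → F x = 0) →
              ∀ I : ℝ,
                I = (∫ x in Metric.ball (0:ℂ) (R + d) \ Metric.closedBall (0:ℂ) R, |v x|) →
                (∀ x, |F x| ≤ C * I) ∧
                (∀ x x' : ℂ, x ≠ x' → |F x - F x'| ≤ C * I * ‖x - x'‖ ^ α) := by
  set r : ℝ := d / 3 with hr
  have hr0 : 0 < r := by positivity
  obtain ⟨K, hK0, hK⟩ := exists_interior_estimate hr0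
  set A : ℝ := C₁ / d + C₂ / d ^ 2 + C₃ / d ^ 3 with hA
  have hA1 : 0 < C₁ / d := by positivity
  have hA2 : 0 < C₂ / d ^ 2 := by positivity
  have hA3 : 0 < C₃ / d ^ 3 := by positivity
  refine ⟨2 * (16 * (K * A)), by positivity, ?_⟩
  intro R hdR _ v hv hint ζ hζ _ _ hsupp hone h1 h2 h3 F hF hF0 J hJ
  set Ω : Set ℂ := ball (0 : ℂ) (R + d) \ closedBall (0 : ℂ) R with hΩ
  have hΩo : IsOpen Ω := isOpen_ball.sdiff isClosed_closedBall
  have hvh : HarmonicOnNhd v Ω := hv.harmonicOnNhd hΩo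
  have hJ0 : 0 ≤ J := hJ ▸ integral_nonneg fun _ => abs_nonneg _
  have hB0 : 0 ≤ 16 * (K * J * A) := by positivity
  have hzero : ∀ (x : ℂ) (c : ℝ), ζ =ᶠ[nhds x] (fun _ => c) → F =ᶠ[nhds x] fun _ => 0 := by
    intro x c h
    filter_upwards [h.eventuallyEq_nhds] with y hy
    by_cases hyΩ : y ∈ Ω
    · rw [hF y hyΩ]; exact leibniz_term_eq_zero hy
    · exact hF0 y hyΩ
  have hflat : ∀ (x : ℂ) (c : ℝ), ζ =ᶠ[nhds x] (fun _ => c) →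
      |F x| ≤ 16 * (K * J * A) ∧ DifferentiableAt ℝ F x ∧ ‖fderiv ℝ F x‖ ≤ 16 * (K * J * A) := by
    intro x c h
    have hz := hzero x c h
    refine ⟨?_, (differentiableAt_const 0).congr_of_eventuallyEq hz, ?_⟩
    · rw [hz.eq_of_nhds]; simpa using hB0
    · rw [hz.fderiv_eq]; simpa using hB0
  have hbound : ∀ x, |F x| ≤ 16 * (K * J * A) ∧ DifferentiableAt ℝ F x ∧
      ‖fderiv ℝ F x‖ ≤ 16 * (K * J * A) := by
    intro x
    rcases lt_or_ge ‖x‖ (R + d / 3) with hx1 | hx1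
    · refine hflat x 1 ?_
      filter_upwards [isOpen_ball.mem_nhds (mem_ball_zero_iff.2 hx1)] with y hy
      exact hone y (ball_subset_closedBall hy)
    rcases le_or_gt (R + 2 * d / 3) ‖x‖ with hx2 | hx2
    · refine hflat x 0 (notMem_tsupport_iff_eventuallyEq.1 fun h => ?_)
      exact absurd (mem_ball_zero_iff.1 (hsupp h)) (not_lt.2 hx2)
    have hsub : ball x r ⊆ Ω := by
      intro y hy
      rw [mem_ball, dist_eq_norm] at hy
      have e1 := norm_sub_norm_le x y
      have e2 := norm_sub_norm_le y x
      rw [norm_sub_rev] at e1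
      simp only [hΩ, mem_sdiff, mem_ball_zero_iff, mem_closedBall_zero_iff, not_le]
      constructor <;> linarith
    have hxΩ : x ∈ Ω := hsub (mem_ball_self hr0)
    obtain ⟨v0, v1, v2⟩ := hK v Ω x hvh hint hsub
    rw [← hJ] at v0 v1 v2
    refine abs_le_and_norm_fderiv_le_of_eventuallyEq (hvh x hxΩ) v0 v1 v2
      (contDiff_infty.1 hζ 3) ((h1 x).trans ?_) ((h2 x).trans ?_)
      ((h3 x).trans ?_) (Filter.eventually_of_mem (hΩo.mem_nhds hxΩ) hF)
    all_goals linarith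
  have hC : 2 * (16 * (K * A)) * J = 2 * (16 * (K * J * A)) := by ring
  rw [hC]
  exact ⟨fun x => by linarith [(hbound x).1], fun x x' hxx' =>
    hoelder_of_abs_le_of_norm_fderiv_le hα0.le hα1.le hbound hxx'⟩
end
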